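/- Let u be a weak supersolution of ∂ₜu + 𝓛u = Δu in Ω × (0,T) with u ≥ 0 on B_R(x₀) × (τ₁, τ₂ + τ), where τ > 0, τ₁ < τ₂, and B_R(x₀) × (τ₁, τ₂ + τ) ⊂ Ω × (0,T). Let 0 < r ≤ 1 with r < R, let l > 0, set v = u + l, let 0 < α < 1 and put ζ₂(1−α) = 4(1−α)/α + 9/(1−α). Then for every nonnegative ψ ∈ C_c^∞(B_r(x₀)) and every nonnegative η ∈ C^∞(ℝ) satisfying η(t) = 1 for τ₁ ≤ t ≤ τ₂ and η(t) = 0 for t ≥ τ₂ + τ one has: esssup_{τ₁ < t < τ₂} ∫_{B_r(x₀)} v(x,t)^α ψ(x)² dx ≤ 2α [ ζ₂(1−α) ∫_{τ₁}^{τ₂+τ} ∫_{B_r(x₀)} ∫_{B_r(x₀)} (ψ(x) − ψ(y))² (v(x,t)^α + v(y,t)^α) η(t) K(x,y,t) dx dy dt + 2Λ ( sup_{x ∈ supp ψ} ∫_{ℝ^N ∖ B_r(x₀)} |x − y|^{−(N+2s)} dy ) ∫_{τ₁}^{τ₂+τ} ∫_{B_r(x₀)} v(x,t)^α ψ(x)²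 η(t) dx dt + (2Λ/l) ( esssup_{τ₁ < t < τ₂+τ} sup_{x ∈ supp ψ} ∫_{ℝ^N ∖ B_R(x₀)} u₋(y,t) |x − y|^{−(N+2s)} dy ) ∫_{τ₁}^{τ₂+τ} ∫_{B_r(x₀)} v(x,t)^α ψ(x)² η(t) dx dt + (2/(1−α)) ∫_{τ₁}^{τ₂+τ} ∫_{B_r(x₀)} v(x,t)^α |∇ψ(x)|² η(t) dx dt + (1/α) ∫_{τ₁}^{τ₂+τ} ∫_{B_r(x₀)} v(x,t)^α ψ(x)² |η'(t)| dx dt ]. -/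

import Mathlib

open MeasureTheory Metric Set
open scoped RealInnerProductSpace ENNReal

noncomputable section

/-- Euclidean space `ℝ^N`. -/
abbrev E (N : ℕ) : Type := EuclideanSpace ℝ (Fin N)

/-- The kernel `K` is measurable, symmetric in its first two arguments, and comparable to
the fractional kernel `|x-y|^{-(N+2s)}` with constant `Λ`, uniformly for `t ∈ (0,T)`. -/
def KernelOK (N : ℕ) (s Λ T : ℝ) (K : E N → E N → ℝ → ℝ) : Prop :=
  Measurable (fun p : E N × E N × ℝ => K p.1 p.2.1 p.2.2) ∧
  (∀ x y t, K x y t = K y x t) ∧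
  ∀ x y : E N, x ≠ y → ∀ t ∈ Set.Ioo 0 T,
    Λ⁻¹ * ‖x - y‖ ^ (-((N : ℝ) + 2 * s)) ≤ K x y t ∧
      K x y t ≤ Λ * ‖x - y‖ ^ (-((N : ℝ) + 2 * s))

/-- `u` is a (bounded, measurable, smooth in `Ω × (0,T)`) weak supersolution of
`∂ₜ u + 𝓛 u = Δ u` in `Ω × (0,T)`. -/
def IsWeakSupersolution (N : ℕ) (T : ℝ) (K : E N → E N → ℝ → ℝ)
    (Ω : Set (E N)) (u : E N → ℝ → ℝ) : Prop :=
  Measurable (fun p : E N × ℝ => u p.1 p.2) ∧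
  (∃ M : ℝ, ∀ x t, t ∈ Set.Ioo 0 T → |u x t| ≤ M) ∧
  ContDiffOn ℝ (⊤ : ℕ∞) (fun p : E N × ℝ => u p.1 p.2) (Ω ×ˢ Set.Ioo 0 T) ∧
  ∀ φ : E N → ℝ → ℝ,
    ContDiff ℝ (⊤ : ℕ∞) (fun p : E N × ℝ => φ p.1 p.2) →
    HasCompactSupport (fun p : E N × ℝ => φ p.1 p.2) →
    tsupport (fun p : E N × ℝ => φ p.1 p.2) ⊆ Ω ×ˢ Set.Ioo 0 T →
    (∀ x t, 0 ≤ φ x t) →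
    0 ≤ -(∫ t in Set.Ioo 0 T, ∫ x in Ω, u x t * deriv (fun τ => φ x τ) t) +
        (∫ t in Set.Ioo 0 T, ∫ x in Ω,
          ⟪gradient (fun y => u y t) x, gradient (fun y => φ y t) x⟫) +
        ∫ t in Set.Ioo 0 T, ∫ x : E N, ∫ y : E N,
          (u x t - u y t) * (φ x t - φ y t) * K x y t

/-- The negative part `u₋ = max(-u, 0)`. -/
def uminus (N : ℕ) (u : E N → ℝ → ℝ) : E N → ℝ → ℝ := fun x t => max (-(u x t)) 0

/-- The parabolic tail `Tail_∞(w; x₀, ρ, t₁, t₂)`. -/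
def tailInfty (N : ℕ) (s : ℝ) (w : E N → ℝ → ℝ) (x₀ : E N) (ρ t₁ t₂ : ℝ) : ℝ :=
  ρ ^ 2 * essSup
      (fun t => ∫ y in (Metric.ball x₀ ρ)ᶜ, |w y t| * ‖y - x₀‖ ^ (-((N : ℝ) + 2 * s)))
      (volume.restrict (Set.Ioo t₁ t₂))


lemma alg_aux {a b p q α : ℝ} (ha : 0 < a) (hb : 0 < b) (hab : b < a) (h0 : 0 < α) (h1 : α < 1) :
    (a - b) * (a ^ (α - 1) * p ^ 2 - b ^ (α - 1) * q ^ 2) ≤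
      1 / (1 - α) * ((p - q) ^ 2 * (a ^ α + b ^ α)) := by
  have hβ : 0 < 1 - α := by linarith
  set X := a ^ (1 - α) with hX
  set Y := b ^ (1 - α) with hY
  have hX0 : 0 < X := Real.rpow_pos_of_pos ha _
  have hY0 : 0 < Y := Real.rpow_pos_of_pos hb _
  have hXY : Y < X := Real.rpow_lt_rpow hb.le hab hβ
  have e1 : a ^ (α - 1) = X⁻¹ := by rw [hX, ← Real.rpow_neg ha.le]; congr 1; ring
  have e2 : b ^ (α - 1) = Y⁻¹ := by rw [hY, ← Real.rpow_neg hb.le]; congr 1; ring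
  have e3 : a ^ α * X = a := by
    rw [hX, ← Real.rpow_add ha]; simp
  have e4 : b ^ α * Y = b := by
    rw [hY, ← Real.rpow_add hb]; simp
  have hm : a ^ α * Y ≤ α * a + (1 - α) * b :=
    Real.geom_mean_le_arith_mean2_weighted h0.le hβ.le ha.le hb.le (by ring)
  have hm2 : b ≤ b ^ α * X := by
    calc b = b ^ α * Y := e4.symm
      _ ≤ _ := by gcongr
  have key : (1 - α) * (a - b) ≤ (a ^ α + b ^ α) * (X - Y) := by nlinarith
  have h2 : X⁻¹ * p ^ 2 - Y⁻¹ * q ^ 2 ≤ (p - q) ^ 2 / (X - Y) := by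
    rw [le_div_iff₀ (by linarith)]
    have : (p - q) ^ 2 - (X⁻¹ * p ^ 2 - Y⁻¹ * q ^ 2) * (X - Y) = (Y * p - X * q) ^ 2 / (X * Y) := by
      field_simp; ring
    have h3 : 0 ≤ (Y * p - X * q) ^ 2 / (X * Y) := by positivity
    linarith
  rw [e1, e2]
  calc (a - b) * (X⁻¹ * p ^ 2 - Y⁻¹ * q ^ 2) ≤ (a - b) * ((p - q) ^ 2 / (X - Y)) := by
        apply mul_le_mul_of_nonneg_left h2; linarith
    _ = (p - q) ^ 2 * ((a - b) / (X - Y)) := by ring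
    _ ≤ (p - q) ^ 2 * (1 / (1 - α) * (a ^ α + b ^ α)) := by
        apply mul_le_mul_of_nonneg_left _ (sq_nonneg _)
        rw [div_le_iff₀ (by linarith), ← sub_nonneg]
        have : 1 / (1 - α) * (a ^ α + b ^ α) * (X - Y) - (a - b)
          = ((a ^ α + b ^ α) * (X - Y) - (1 - α) * (a - b)) / (1 - α) := by
          field_simp
        rw [this]
        apply div_nonneg _ hβ.le
        linarith
    _ = _ := by ring

lemma alg_ineq {a b p q α : ℝ} (ha : 0 < a) (hb : 0 < b) (h0 : 0 < α) (h1 : α < 1) :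
    (a - b) * (a ^ (α - 1) * p ^ 2 - b ^ (α - 1) * q ^ 2) ≤
      1 / (1 - α) * ((p - q) ^ 2 * (a ^ α + b ^ α)) := by
  have hβ : 0 < 1 - α := by linarith
  rcases lt_trichotomy b a with h | h | h
  · exact alg_aux ha hb h h0 h1
  · subst h
    simp only [sub_self, zero_mul]
    positivity
  · have := alg_aux (p := q) (q := p) hb ha h h0 h1
    calc _ = (b - a) * (b ^ (α - 1) * q ^ 2 - a ^ (α - 1) * p ^ 2) := by ring
      _ ≤ _ := this
      _ = _ := by ring

lemma integral_le_trick {X : Type*} [MeasurableSpace X] {μ : Measure X} {f g : X → ℝ}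
    (hfg : f ≤ᵐ[μ] g) (hg : 0 ≤ᵐ[μ] g) (hgi : Integrable g μ) : ∫ x, f x ∂μ ≤ ∫ x, g x ∂μ := by
  by_cases hf : Integrable f μ
  · exact integral_mono_ae hf hgi hfg
  · rw [integral_undef hf]
    exact integral_nonneg_of_ae hg

lemma grad_alg {F : Type*} [NormedAddCommGroup F] [InnerProductSpace ℝ F] (a b : F) {v p α : ℝ}
    (hv : 0 < v) (h1 : α < 1) :
    ⟪a, (p ^ 2 * ((α - 1) * v ^ (α - 2))) • a + (v ^ (α - 1) * (2 * p)) • b⟫ ≤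
      1 / (1 - α) * (v ^ α * ‖b‖ ^ 2) := by
  have hβ : 0 < 1 - α := by linarith
  rw [inner_add_right, inner_smul_right, inner_smul_right, real_inner_self_eq_norm_sq]
  have e1 : v ^ (α - 1) = v ^ (α - 2) * v := by
    rw [← Real.rpow_add_one hv.ne']; congr 1; ring
  have e2 : v ^ α = v ^ (α - 2) * v ^ 2 := by
    rw [← Real.rpow_natCast, ← Real.rpow_add hv]; congr 1; push_cast; ring
  have hw : 0 < v ^ (α - 2) := Real.rpow_pos_of_pos hv _
  have hcs : (⟪a, b⟫ : ℝ) ≤ ‖a‖ * ‖b‖ := real_inner_le_norm a b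
  have hcs2 : |(⟪a, b⟫ : ℝ)| ≤ ‖a‖ * ‖b‖ := abs_real_inner_le_norm a b
  have h3 : p * (⟪a, b⟫ : ℝ) ≤ |p| * (‖a‖ * ‖b‖) := by
    calc p * (⟪a, b⟫ : ℝ) ≤ |p * (⟪a, b⟫ : ℝ)| := le_abs_self _
      _ = |p| * |(⟪a, b⟫ : ℝ)| := abs_mul _ _
      _ ≤ _ := by gcongr
  rw [e1, e2]
  set W := v ^ (α - 2)
  have h4 : 0 ≤ W * ((1 - α) * |p| * ‖a‖ - v * ‖b‖) ^ 2 / (1 - α) := by positivity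
  have h5 : W * ((1 - α) * |p| * ‖a‖ - v * ‖b‖) ^ 2 / (1 - α) =
     (1 - α) * |p| ^ 2 * ‖a‖ ^ 2 * W - 2 * W * v * (|p| * (‖a‖ * ‖b‖))
      + 1 / (1 - α) * (W * v ^ 2 * ‖b‖ ^ 2) := by
    field_simp; ring
  rw [sq_abs] at h5
  have h6 : 2 * W * v * (p * (⟪a, b⟫ : ℝ)) ≤ 2 * W * v * (|p| * (‖a‖ * ‖b‖)) := by gcongr
  nlinarith

lemma k_far (N : ℕ) (hN : 2 ≤ N) {s δ : ℝ} (hs : 0 < s) (hδ : 0 < δ) :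
    Integrable (fun z : E N => if δ ≤ ‖z‖ then ‖z‖ ^ (-((N : ℝ) + 2 * s)) else 0) := by
  have : Nontrivial (E N) := by
    have : Nonempty (Fin N) := ⟨⟨0, by omega⟩⟩
    infer_instance
  rw [MeasureTheory.integrable_fun_norm_addHaar (volume : Measure (E N))
    (f := fun y : ℝ => if δ ≤ y then y ^ (-((N : ℝ) + 2 * s)) else 0)]
  have h1 : IntegrableOn (fun y : ℝ => y ^ (-1 - 2 * s)) (Ioi (δ/2)) :=
    integrableOn_Ioi_rpow_of_lt (by linarith) (by linarith)
  have h2 : IntegrableOn (fun y : ℝ => y ^ (-1 - 2 * s)) (Ici δ) := h1.mono_set (by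
    intro y hy; simp at *; linarith)
  have h3 := h2.integrable_indicator measurableSet_Ici
  refine h3.integrableOn.congr_fun ?_ measurableSet_Ioi
  intro y hy
  have hy0 : (0 : ℝ) < y := hy
  simp only [indicator, mem_Ici, smul_eq_mul, finrank_euclideanSpace_fin]
  split_ifs with h
  · rw [← Real.rpow_natCast, ← Real.rpow_add hy0]
    congr 1
    rw [Nat.cast_sub (by omega)]; push_cast; ring
  · simp

lemma k_near (N : ℕ) (hN : 2 ≤ N) {s ρ : ℝ} (hs : s < 1) (hρ : 0 < ρ) :
    Integrable (fun z : E N => if ‖z‖ < ρ then ‖z‖ ^ (2 - ((N : ℝ) + 2 * s)) else 0) := by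
  have : Nontrivial (E N) := by
    have : Nonempty (Fin N) := ⟨⟨0, by omega⟩⟩
    infer_instance
  rw [MeasureTheory.integrable_fun_norm_addHaar (volume : Measure (E N))
    (f := fun y : ℝ => if y < ρ then y ^ (2 - ((N : ℝ) + 2 * s)) else 0)]
  have h1 : IntegrableOn (fun y : ℝ => y ^ (1 - 2 * s)) (Ioo 0 ρ) :=
    (intervalIntegral.integrableOn_Ioo_rpow_iff hρ).2 (by linarith)
  have h3 := h1.integrable_indicator measurableSet_Ioo
  refine h3.integrableOn.congr_fun ?_ measurableSet_Ioi
  intro y hy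
  have hy0 : (0 : ℝ) < y := hy
  simp only [indicator, mem_Ioo, smul_eq_mul, finrank_euclideanSpace_fin, hy0, true_and]
  split_ifs with h
  · rw [← Real.rpow_natCast, ← Real.rpow_add hy0]
    congr 1
    rw [Nat.cast_sub (by omega)]; push_cast; ring
  · simp

/-- bundled fixed-time integrability of near part -/
lemma near_integrable (N : ℕ) (hN : 2 ≤ N) {s Λ : ℝ} (hs : s < 1) (hΛ : 1 ≤ Λ)
    (K : E N → E N → ℝ) (hKm : Measurable (fun p : E N × E N => K p.1 p.2))
    (hKb : ∀ x y : E N, x ≠ y → 0 ≤ K x y ∧ K x y ≤ Λ * ‖x - y‖ ^ (-((N : ℝ) + 2 * s)))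
    (x₀ : E N) {r : ℝ} (hr : 0 < r) (ψ : E N → ℝ) (hψm : Measurable ψ) {L : ℝ}
    (hL : ∀ x y, |ψ x - ψ y| ≤ L * ‖x - y‖) (V : E N → ℝ) (hVm : Measurable V) {C : ℝ}
    (hV0 : ∀ x ∈ ball x₀ r, 0 ≤ V x) (hV : ∀ x ∈ ball x₀ r, V x ≤ C) (c : ℝ) (hc : 0 ≤ c) :
    (∀ x y, (ball x₀ r ×ˢ ball x₀ r).indicator
      (fun p : E N × E N => (ψ p.1 - ψ p.2) ^ 2 * (V p.1 + V p.2) * c * K p.1 p.2) (x, y) ≤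
      (ball x₀ r).indicator (fun _ => L ^ 2 * (2 * C) * c * Λ) x *
        (if ‖y - x‖ < 2 * r then ‖y - x‖ ^ (2 - ((N : ℝ) + 2 * s)) else 0)) ∧
    (∀ p, 0 ≤ (ball x₀ r ×ˢ ball x₀ r).indicator
      (fun p : E N × E N => (ψ p.1 - ψ p.2) ^ 2 * (V p.1 + V p.2) * c * K p.1 p.2) p) ∧
    Integrable ((ball x₀ r ×ˢ ball x₀ r).indicator
      (fun p : E N × E N => (ψ p.1 - ψ p.2) ^ 2 * (V p.1 + V p.2) * c * K p.1 p.2))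
      (volume.prod volume) := by
  have hC : 0 ≤ C := (hV0 x₀ (mem_ball_self hr)).trans (hV x₀ (mem_ball_self hr))
  have hL0 : 0 ≤ L ^ 2 * (2 * C) * c * Λ := by positivity
  have hnn : ∀ p, 0 ≤ (ball x₀ r ×ˢ ball x₀ r).indicator
      (fun p : E N × E N => (ψ p.1 - ψ p.2) ^ 2 * (V p.1 + V p.2) * c * K p.1 p.2) p := by
    intro p
    apply indicator_nonneg
    rintro ⟨x, y⟩ ⟨hx, hy⟩
    simp only at hx hy ⊢
    by_cases hxy : x = y
    · subst hxy; simp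
    · have h1 := (hKb x y hxy).1
      have h2 := hV0 x hx
      have h3 := hV0 y hy
      positivity
  have hle : ∀ x y, (ball x₀ r ×ˢ ball x₀ r).indicator
      (fun p : E N × E N => (ψ p.1 - ψ p.2) ^ 2 * (V p.1 + V p.2) * c * K p.1 p.2) (x, y) ≤
      (ball x₀ r).indicator (fun _ => L ^ 2 * (2 * C) * c * Λ) x *
        (if ‖y - x‖ < 2 * r then ‖y - x‖ ^ (2 - ((N : ℝ) + 2 * s)) else 0) := by
    intro x y
    have hnnr : 0 ≤ (ball x₀ r).indicator (fun _ => L ^ 2 * (2 * C) * c * Λ) x *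
        (if ‖y - x‖ < 2 * r then ‖y - x‖ ^ (2 - ((N : ℝ) + 2 * s)) else 0) := by
      apply mul_nonneg
      · exact indicator_nonneg (fun _ _ => hL0) _
      · split_ifs <;> positivity
    by_cases hx : x ∈ ball x₀ r
    swap
    · rw [indicator_of_notMem (fun h => hx h.1)]
      exact hnnr
    by_cases hy : y ∈ ball x₀ r
    swap
    · rw [indicator_of_notMem (fun h => hy h.2)]
      exact hnnr
    by_cases hxy : x = y
    · subst hxy
      rw [indicator_of_mem (by exact ⟨hx, hx⟩)]
      simpa using hnnr
    have hlt : ‖y - x‖ < 2 * r := by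
      rw [← dist_eq_norm]
      have := dist_triangle_right y x x₀
      simp only [mem_ball] at hx hy
      linarith
    rw [indicator_of_mem (by exact ⟨hx, hy⟩), indicator_of_mem hx, if_pos hlt]
    have hpos : 0 < ‖y - x‖ := by
      rw [norm_pos_iff]; intro h; exact hxy (sub_eq_zero.1 h).symm
    obtain ⟨hK0, hK1⟩ := hKb x y hxy
    rw [norm_sub_rev] at hK1
    have e : ‖y - x‖ ^ (2 - ((N : ℝ) + 2 * s)) = ‖y - x‖ ^ 2 * ‖y - x‖ ^ (-((N : ℝ) + 2 * s)) := by
      rw [sub_eq_add_neg (2 : ℝ), Real.rpow_add hpos]; norm_cast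
    have h1 : (ψ x - ψ y) ^ 2 ≤ L ^ 2 * ‖y - x‖ ^ 2 := by
      rw [← mul_pow, ← sq_abs, norm_sub_rev]
      exact pow_le_pow_left₀ (abs_nonneg _) (hL x y) 2
    have h2 : V x + V y ≤ 2 * C := by have := hV x hx; have := hV y hy; linarith
    have h3 : 0 ≤ V x + V y := add_nonneg (hV0 x hx) (hV0 y hy)
    calc (ψ x - ψ y) ^ 2 * (V x + V y) * c * K x y
        ≤ (L ^ 2 * ‖y - x‖ ^ 2) * (2 * C) * c * (Λ * ‖y - x‖ ^ (-((N : ℝ) + 2 * s))) := by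
          gcongr
      _ = _ := by rw [e]; ring
  refine ⟨hle, hnn, ?_⟩
  have hint := Integrable.convolution_integrand (ContinuousLinearMap.mul ℝ ℝ)
    (f := (ball x₀ r).indicator (fun _ => L ^ 2 * (2 * C) * c * Λ))
    (((integrable_indicator_iff measurableSet_ball).2
      (integrableOn_const (measure_ball_lt_top).ne)) : Integrable _ (volume : Measure (E N)))
    (k_near N hN (ρ := 2 * r) hs (by linarith))
  refine hint.swap.mono' ?_ ?_
  · refine (Measurable.indicator ?_ (measurableSet_ball.prod measurableSet_ball)).aestronglyMeasurable
    fun_prop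
  · refine Filter.Eventually.of_forall ?_
    rintro ⟨x, y⟩
    rw [Real.norm_of_nonneg (hnn _)]
    exact hle x y

lemma far_integrable (N : ℕ) (hN : 2 ≤ N) {s δ : ℝ} (hs : 0 < s) (hδ : 0 < δ) {A : Set (E N)}
    (hA : MeasurableSet A) (x : E N) (hx : ∀ y ∈ A, δ ≤ ‖x - y‖) {w : E N → ℝ} (hw : Measurable w)
    {M : ℝ} (hM : ∀ y, |w y| ≤ M) :
    IntegrableOn (fun y => w y * ‖x - y‖ ^ (-((N : ℝ) + 2 * s))) A := by
  have h1 := ((k_far N hN hs hδ).comp_sub_left x).const_mul M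
  refine (h1.integrableOn (s := A)).mono' ?_ ?_
  · exact Measurable.aestronglyMeasurable (by fun_prop)
  · filter_upwards [ae_restrict_mem hA] with y hy
    rw [if_pos (hx y hy), norm_mul, Real.norm_eq_abs, Real.norm_of_nonneg (by positivity)]
    gcongr
    exact hM y

lemma far_bound (N : ℕ) (hN : 2 ≤ N) {s δ : ℝ} (hs : 0 < s) (hδ : 0 < δ) {A : Set (E N)}
    (hA : MeasurableSet A) (x : E N) (hx : ∀ y ∈ A, δ ≤ ‖x - y‖) {w : E N → ℝ} (hw : Measurable w)
    {M : ℝ} (hM : ∀ y, |w y| ≤ M) :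
    ∫ y in A, w y * ‖x - y‖ ^ (-((N : ℝ) + 2 * s)) ≤
      M * ∫ z : E N, (if δ ≤ ‖z‖ then ‖z‖ ^ (-((N : ℝ) + 2 * s)) else 0) := by
  have hM0 : 0 ≤ M := (abs_nonneg _).trans (hM 0)
  have h1 := ((k_far N hN hs hδ).comp_sub_left x).const_mul M
  rw [← integral_const_mul, ← integral_sub_left_eq_self
    (fun z : E N => M * (if δ ≤ ‖z‖ then ‖z‖ ^ (-((N : ℝ) + 2 * s)) else 0)) volume x]
  refine le_trans (integral_mono_ae (far_integrable N hN hs hδ hA x hx hw hM) h1.integrableOn ?_)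
    (setIntegral_le_integral h1 ?_)
  · filter_upwards [ae_restrict_mem hA] with y hy
    rw [if_pos (hx y hy)]
    gcongr
    exact (le_abs_self _).trans (hM y)
  · refine Filter.Eventually.of_forall fun y => ?_
    simp only [Pi.zero_apply]
    split_ifs <;> positivity

lemma far_prod (N : ℕ) (hN : 2 ≤ N) {s δ : ℝ} (hs : 0 < s) (hδ : 0 < δ) {A S : Set (E N)}
    (hA : MeasurableSet A) (hx : ∀ x ∈ S, ∀ y ∈ A, δ ≤ ‖x - y‖)
    {P m : E N → ℝ} (hPi : Integrable P) (hPm : Measurable P) (hP0 : ∀ x, 0 ≤ P x)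
    (hPS : ∀ x, x ∉ S → P x = 0)
    (hm : Measurable m) (hm0 : ∀ y, 0 ≤ m y) {C : ℝ} (hmC : ∀ y, m y ≤ C) {D : ℝ}
    (hD : ∀ x ∈ S, ∫ y in A, m y * ‖x - y‖ ^ (-((N : ℝ) + 2 * s)) ≤ D) :
    (∀ p, 0 ≤ (univ ×ˢ A : Set (E N × E N)).indicator
      (fun p : E N × E N => P p.1 * (m p.2 * ‖p.1 - p.2‖ ^ (-((N : ℝ) + 2 * s)))) p) ∧
    Integrable ((univ ×ˢ A : Set (E N × E N)).indicator
      (fun p : E N × E N => P p.1 * (m p.2 * ‖p.1 - p.2‖ ^ (-((N : ℝ) + 2 * s)))))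
      (volume.prod volume) ∧
    ∫ p, (univ ×ˢ A : Set (E N × E N)).indicator
      (fun p : E N × E N => P p.1 * (m p.2 * ‖p.1 - p.2‖ ^ (-((N : ℝ) + 2 * s)))) p
      ∂(volume.prod volume) ≤ D * ∫ x, P x := by
  have hnn : ∀ p, 0 ≤ (univ ×ˢ A : Set (E N × E N)).indicator
      (fun p : E N × E N => P p.1 * (m p.2 * ‖p.1 - p.2‖ ^ (-((N : ℝ) + 2 * s)))) p := by
    intro p
    apply indicator_nonneg
    rintro ⟨x, y⟩ _
    have := hP0 x
    have := hm0 y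
    simp only
    positivity
  have hC : 0 ≤ C := (hm0 0).trans (hmC 0)
  have hint := Integrable.convolution_integrand (ContinuousLinearMap.mul ℝ ℝ)
    (f := fun x => P x * C) (hPi.mul_const C) (k_far N hN hs hδ)
  have hI : Integrable ((univ ×ˢ A : Set (E N × E N)).indicator
      (fun p : E N × E N => P p.1 * (m p.2 * ‖p.1 - p.2‖ ^ (-((N : ℝ) + 2 * s)))))
      (volume.prod volume) := by
    refine hint.swap.mono' ?_ ?_
    · refine (Measurable.indicator ?_ (MeasurableSet.univ.prod hA)).aestronglyMeasurable
      fun_prop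
    · refine Filter.Eventually.of_forall ?_
      rintro ⟨x, y⟩
      rw [Real.norm_of_nonneg (hnn _)]
      simp only [Function.comp, Prod.swap, ContinuousLinearMap.mul_apply']
      by_cases hxS : x ∈ S
      swap
      · simp [hPS x hxS, indicator]
      by_cases hy : y ∈ A
      · rw [indicator_of_mem (by exact ⟨mem_univ _, hy⟩)]
        rw [if_pos (by rw [norm_sub_rev]; exact hx x hxS y hy)]
        simp only
        rw [norm_sub_rev x y, mul_assoc]
        have := hP0 x
        have := hmC y
        gcongr
      · rw [indicator_of_notMem (fun h => hy h.2)]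
        have := hP0 x
        split_ifs <;> positivity
  refine ⟨hnn, hI, ?_⟩
  rw [integral_prod _ hI, ← integral_const_mul]
  refine integral_mono hI.integral_prod_left (hPi.const_mul D) ?_
  intro x
  simp only
  have e : (fun y => (univ ×ˢ A : Set (E N × E N)).indicator
      (fun p : E N × E N => P p.1 * (m p.2 * ‖p.1 - p.2‖ ^ (-((N : ℝ) + 2 * s)))) (x, y)) =
      A.indicator (fun y => P x * (m y * ‖x - y‖ ^ (-((N : ℝ) + 2 * s)))) := by
    ext y
    by_cases hy : y ∈ A
    · rw [indicator_of_mem hy, indicator_of_mem (by exact ⟨mem_univ _, hy⟩)]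
    · rw [indicator_of_notMem hy, indicator_of_notMem (fun h => hy h.2)]
  rw [e, integral_indicator hA, integral_const_mul, mul_comm D]
  by_cases hxS : x ∈ S
  · exact mul_le_mul_of_nonneg_left (hD x hxS) (hP0 x)
  · simp [hPS x hxS]

lemma nonlocal_est (N : ℕ) (hN : 2 ≤ N) {s Λ : ℝ} (hs : s ∈ Ioo (0 : ℝ) 1) (hΛ : 1 ≤ Λ)
    (K : E N → E N → ℝ) (hKm : Measurable (fun p : E N × E N => K p.1 p.2))
    (hKs : ∀ x y, K x y = K y x)
    (hKb : ∀ x y : E N, x ≠ y → 0 ≤ K x y ∧ K x y ≤ Λ * ‖x - y‖ ^ (-((N : ℝ) + 2 * s)))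
    (x₀ : E N) {R r l α M L : ℝ} (hr : 0 < r) (hrR : r < R) (hl : 0 < l) (hα : α ∈ Ioo (0 : ℝ) 1)
    (w : E N → ℝ) (hwm : Measurable w) (hwM : ∀ x, |w x| ≤ M) (hw0 : ∀ x ∈ ball x₀ R, 0 ≤ w x)
    (ψ : E N → ℝ) (hψm : Measurable ψ) (hL : ∀ x y, |ψ x - ψ y| ≤ L * ‖x - y‖)
    {C : ℝ} (hψC : ∀ x, ψ x ^ 2 ≤ C) {S : Set (E N)} (hS : S ⊆ ball x₀ r)
    (hψS : ∀ x, x ∉ S → ψ x = 0) {δ : ℝ} (hδ : 0 < δ)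
    (hSδ : ∀ x ∈ S, ∀ y ∈ (ball x₀ r)ᶜ, δ ≤ ‖x - y‖)
    {θ η : ℝ} (hθ : 0 ≤ θ) (hθη : θ ≤ 2 * η) (φ : E N → ℝ)
    (hφ : ∀ x, φ x = (w x + l) ^ (α - 1) * ψ x ^ 2 * θ) {S1 S2 : ℝ}
    (hS1 : ∀ x ∈ S, ∫ y in (ball x₀ r)ᶜ, ‖x - y‖ ^ (-((N : ℝ) + 2 * s)) ≤ S1)
    (hS2 : ∀ x ∈ S, ∫ y in (ball x₀ R)ᶜ, max (-(w y)) 0 * ‖x - y‖ ^ (-((N : ℝ) + 2 * s)) ≤ S2) :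
    ∫ x, ∫ y, (w x - w y) * (φ x - φ y) * K x y ≤
      2 * (1 / (1 - α) * (∫ x in ball x₀ r, ∫ y in ball x₀ r,
          (ψ x - ψ y) ^ 2 * ((w x + l) ^ α + (w y + l) ^ α) * η * K x y)
        + (2 * Λ * S1 + 2 * Λ / l * S2) * ∫ x in ball x₀ r, (w x + l) ^ α * ψ x ^ 2 * η) := by
  obtain ⟨hα0, hα1⟩ := hα
  have hβ : 0 < 1 - α := by linarith
  have hη : 0 ≤ η := by linarith
  have hsub : ball x₀ r ⊆ ball x₀ R := ball_subset_ball hrR.le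
  have hM0 : 0 ≤ M := (abs_nonneg _).trans (hwM 0)
  have hv : ∀ x ∈ ball x₀ r, 0 < w x + l := fun x hx => by have := hw0 x (hsub hx); linarith
  have hvC : ∀ x ∈ ball x₀ r, (w x + l) ^ α ≤ (M + l) ^ α := fun x hx =>
    Real.rpow_le_rpow (hv x hx).le (by have := (abs_le.1 (hwM x)).2; linarith) hα0.le
  obtain ⟨-, hn1, hI1⟩ := near_integrable N hN hs.2 hΛ K hKm hKb x₀ hr ψ hψm hL
    (fun x => (w x + l) ^ α) (by fun_prop) (fun x hx => (Real.rpow_pos_of_pos (hv x hx) _).le)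
    hvC η hη
  set G1 := (ball x₀ r ×ˢ ball x₀ r).indicator
      (fun p : E N × E N => (ψ p.1 - ψ p.2) ^ 2 * ((w p.1 + l) ^ α + (w p.2 + l) ^ α) * η * K p.1 p.2) with hG1
  set P : E N → ℝ := (ball x₀ r).indicator (fun x => (w x + l) ^ α * ψ x ^ 2 * η) with hP
  have hC0 : 0 ≤ C := (sq_nonneg _).trans (hψC 0)
  have hPm : Measurable P := Measurable.indicator (by fun_prop) measurableSet_ball
  have hP0 : ∀ x, 0 ≤ P x := by
    intro x
    apply indicator_nonneg
    intro x hx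
    have := Real.rpow_pos_of_pos (hv x hx) α
    positivity
  have hPi : Integrable P := by
    rw [hP, integrable_indicator_iff measurableSet_ball]
    refine IntegrableOn.of_bound (C := (M + l) ^ α * C * η) measure_ball_lt_top
      (Measurable.aestronglyMeasurable (by fun_prop)) ?_
    filter_upwards [ae_restrict_mem measurableSet_ball] with x hx
    have h1 := Real.rpow_pos_of_pos (hv x hx) α
    rw [Real.norm_of_nonneg (by positivity)]
    have := hvC x hx
    have := hψC x
    gcongr
  set m : E N → ℝ := fun y => 1 + (ball x₀ R)ᶜ.indicator (fun y => max (-(w y)) 0) y / l with hm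
  have hmi : ∀ y, 0 ≤ (ball x₀ R)ᶜ.indicator (fun y => max (-(w y)) 0) y := fun y =>
    indicator_nonneg (fun y _ => le_max_right _ _) y
  have hmm : Measurable m := by
    have : Measurable ((ball x₀ R)ᶜ.indicator (fun y => max (-(w y)) 0)) :=
      Measurable.indicator (by fun_prop) measurableSet_ball.compl
    fun_prop
  have hmiM : ∀ y, (ball x₀ R)ᶜ.indicator (fun y => max (-(w y)) 0) y ≤ M := by
    intro y
    apply indicator_le' (fun y _ => ?_) (fun _ _ => hM0)
    exact max_le (by have := (abs_le.1 (hwM y)).1; linarith) hM0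
  have hm0 : ∀ y, 0 ≤ m y := fun y => by have := hmi y; simp only [hm]; positivity
  have hmC : ∀ y, m y ≤ 1 + M / l := fun y => by
    have := hmiM y; simp only [hm]; gcongr
  have hmeasBc : MeasurableSet (ball x₀ r)ᶜ := measurableSet_ball.compl
  have hmeasRc : MeasurableSet (ball x₀ R)ᶜ := measurableSet_ball.compl
  have hSD : ∀ x ∈ S, ∫ y in (ball x₀ r)ᶜ, m y * ‖x - y‖ ^ (-((N : ℝ) + 2 * s)) ≤
      S1 + S2 / l := by
    intro x hx
    have i1 := far_integrable N hN hs.1 hδ hmeasBc x (hSδ x hx) (w := fun _ => 1)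
      (by fun_prop) (M := 1) (by simp)
    have i2 := far_integrable N hN hs.1 hδ hmeasBc x (hSδ x hx)
      (w := (ball x₀ R)ᶜ.indicator (fun y => max (-(w y)) 0))
      (Measurable.indicator (by fun_prop) hmeasRc) (M := M)
      (fun y => by rw [abs_of_nonneg (hmi y)]; exact hmiM y)
    have e : ∀ y, m y * ‖x - y‖ ^ (-((N : ℝ) + 2 * s)) = 1 * ‖x - y‖ ^ (-((N : ℝ) + 2 * s)) +
        ((ball x₀ R)ᶜ.indicator (fun y => max (-(w y)) 0) y * ‖x - y‖ ^ (-((N : ℝ) + 2 * s))) / l := by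
      intro y; simp only [hm]; ring
    simp only [e]
    rw [integral_add i1 (i2.div_const l), integral_div]
    simp only [one_mul]
    have e2 : ∫ y in (ball x₀ r)ᶜ, (ball x₀ R)ᶜ.indicator (fun y => max (-(w y)) 0) y *
        ‖x - y‖ ^ (-((N : ℝ) + 2 * s)) =
        ∫ y in (ball x₀ R)ᶜ, max (-(w y)) 0 * ‖x - y‖ ^ (-((N : ℝ) + 2 * s)) := by
      simp_rw [← indicator_mul_left (ball x₀ R)ᶜ (fun y => max (-(w y)) 0)
        (fun y => ‖x - y‖ ^ (-((N : ℝ) + 2 * s)))]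
      rw [setIntegral_indicator hmeasRc]
      congr 2
      exact inter_eq_right.2 (compl_subset_compl.2 hsub)
    rw [e2]
    have := hS1 x hx
    have := hS2 x hx
    gcongr
  have hPS : ∀ x, x ∉ S → P x = 0 := by
    intro x hx; simp [hP, indicator, hψS x hx]
  obtain ⟨hn2, hI2, hB2⟩ := far_prod N hN hs.1 hδ hmeasBc hSδ hPi hPm hP0 hPS hmm hm0 hmC hSD
  set G2 := (univ ×ˢ (ball x₀ r)ᶜ : Set (E N × E N)).indicator
      (fun p : E N × E N => P p.1 * (m p.2 * ‖p.1 - p.2‖ ^ (-((N : ℝ) + 2 * s)))) with hG2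
  -- cross term bound
  have hcross : ∀ x y, x ∈ ball x₀ r → y ∉ ball x₀ r →
      (w x - w y) * φ x * K x y ≤ 2 * Λ * G2 (x, y) := by
    intro x y hx hy
    have hxy : x ≠ y := by rintro rfl; exact hy hx
    obtain ⟨hK0, hK1⟩ := hKb x y hxy
    have hvx := hv x hx
    have hφ0 : 0 ≤ φ x := by rw [hφ]; have := Real.rpow_pos_of_pos hvx (α - 1); positivity
    have e0 : G2 (x, y) = (w x + l) ^ α * ψ x ^ 2 * η * (m y * ‖x - y‖ ^ (-((N : ℝ) + 2 * s))) := by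
      rw [hG2, indicator_of_mem (by exact ⟨mem_univ _, hy⟩), hP]
      simp only
      rw [indicator_of_mem hx]
    have h1 : w x - w y ≤ (w x + l) * m y := by
      simp only [hm]
      by_cases hyR : y ∈ ball x₀ R
      · rw [indicator_of_notMem (by simpa using hyR)]
        have := hw0 y hyR
        simp only [zero_div, add_zero, mul_one]
        linarith
      · rw [indicator_of_mem (by exact hyR)]
        have h2 : 0 ≤ w x := hw0 x (hsub hx)
        have h3 : -(w y) ≤ max (-(w y)) 0 := le_max_left _ _
        have h4 : 0 ≤ max (-(w y)) 0 := le_max_right _ _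
        have h5 : max (-(w y)) 0 ≤ (w x + l) * (max (-(w y)) 0 / l) := by
          rw [mul_div_assoc', le_div_iff₀ hl]
          nlinarith
        rw [mul_add]
        linarith
    have e3 : (w x + l) ^ α = (w x + l) * (w x + l) ^ (α - 1) := by
      rw [mul_comm, ← Real.rpow_add_one hvx.ne']; congr 1; ring
    have hq := Real.rpow_pos_of_pos hvx (α - 1)
    have hmy := hm0 y
    calc (w x - w y) * φ x * K x y ≤ (w x + l) * m y * φ x * K x y := by gcongr
      _ ≤ (w x + l) * m y * ((w x + l) ^ (α - 1) * ψ x ^ 2 * (2 * η)) *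
          (Λ * ‖x - y‖ ^ (-((N : ℝ) + 2 * s))) := by
            rw [hφ]; gcongr
      _ = 2 * Λ * G2 (x, y) := by rw [e0, e3]; ring
  set G : E N × E N → ℝ := fun p => 2 / (1 - α) * G1 p + 2 * Λ * (G2 p + G2 p.swap) with hG
  have hG0 : ∀ p, 0 ≤ G p := by
    intro p
    have := hn1 p
    have := hn2 p
    have := hn2 p.swap
    simp only [hG]; positivity
  have hFG : ∀ x y, (w x - w y) * (φ x - φ y) * K x y ≤ G (x, y) := by
    intro x y
    have hout : ∀ z, z ∉ ball x₀ r → φ z = 0 := fun z hz => by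
      rw [hφ, hψS z (fun h => hz (hS h))]; simp
    by_cases hxy : x = y
    · subst hxy; simpa using hG0 (x, x)
    by_cases hx : x ∈ ball x₀ r <;> by_cases hy : y ∈ ball x₀ r
    · have hK0 := (hKb x y hxy).1
      have h2 := hn2 (x, y)
      have h3 := hn2 (y, x)
      have e1 : G1 (x, y) = (ψ x - ψ y) ^ 2 * ((w x + l) ^ α + (w y + l) ^ α) * η * K x y := by
        rw [hG1, indicator_of_mem (by exact ⟨hx, hy⟩)]
      have h4 := alg_ineq (p := ψ x) (q := ψ y) (hv x hx) (hv y hy) hα0 hα1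
      have h5 : 0 ≤ 1 / (1 - α) * ((ψ x - ψ y) ^ 2 * ((w x + l) ^ α + (w y + l) ^ α)) := by
        have := Real.rpow_pos_of_pos (hv x hx) α
        have := Real.rpow_pos_of_pos (hv y hy) α
        positivity
      have h6 : (w x - w y) * (φ x - φ y) * K x y ≤ 2 / (1 - α) * G1 (x, y) := by
        calc (w x - w y) * (φ x - φ y) * K x y = ((w x + l) - (w y + l)) *
            ((w x + l) ^ (α - 1) * ψ x ^ 2 - (w y + l) ^ (α - 1) * ψ y ^ 2) * θ * K x y := by
              rw [hφ, hφ]; ring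
          _ ≤ 1 / (1 - α) * ((ψ x - ψ y) ^ 2 * ((w x + l) ^ α + (w y + l) ^ α)) * (2 * η) * K x y := by
              gcongr
          _ = _ := by rw [e1]; ring
      have h7 : 0 ≤ 2 * Λ * (G2 (x, y) + G2 (y, x)) := by positivity
      simp only [hG, Prod.swap]
      linarith
    · have h1 := hcross x y hx hy
      have h2 := hn1 (x, y)
      have h3 := hn2 (y, x)
      have h4 : 0 ≤ 2 / (1 - α) * G1 (x, y) := by positivity
      have h5 : 0 ≤ 2 * Λ * G2 (y, x) := by positivity
      simp only [hG, Prod.swap]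
      rw [hout y hy, sub_zero]
      linarith
    · have h1 := hcross y x hy hx
      have h2 := hn1 (x, y)
      have h3 := hn2 (x, y)
      have h4 : 0 ≤ 2 / (1 - α) * G1 (x, y) := by positivity
      have h5 : 0 ≤ 2 * Λ * G2 (x, y) := by positivity
      simp only [hG, Prod.swap]
      rw [hout x hx, hKs x y]
      linarith
    · rw [hout x hx, hout y hy]; simpa using hG0 (x, y)
  have hGI : Integrable G (volume.prod volume) :=
    (hI1.const_mul _).add ((hI2.add hI2.swap).const_mul _)
  have hstep : ∫ x, ∫ y, (w x - w y) * (φ x - φ y) * K x y ≤ ∫ p, G p ∂(volume.prod volume) := by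
    rw [integral_prod _ hGI]
    refine integral_le_trick ?_ ?_ hGI.integral_prod_left
    · filter_upwards [hGI.prod_right_ae] with x hx
      exact integral_le_trick (Filter.Eventually.of_forall (hFG x))
        (Filter.Eventually.of_forall fun y => hG0 _) hx
    · exact Filter.Eventually.of_forall fun x => integral_nonneg fun y => hG0 _
  refine hstep.trans ?_
  have eG : ∫ p, G p ∂(volume.prod volume) = 2 / (1 - α) * (∫ p, G1 p ∂(volume.prod volume)) +
      2 * Λ * ((∫ p, G2 p ∂(volume.prod volume)) + ∫ p, G2 p ∂(volume.prod volume)) := by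
    have hsw : Integrable (fun p : E N × E N => G2 p.swap) (volume.prod volume) := hI2.swap
    simp only [hG]
    have hadd : Integrable (fun p : E N × E N => G2 p + G2 p.swap) (volume.prod volume) :=
      hI2.add hsw
    rw [integral_add (hI1.const_mul _) (hadd.const_mul _), integral_const_mul,
      integral_const_mul, integral_add hI2 hsw, integral_prod_swap]
  have e1 : ∫ p, G1 p ∂(volume.prod volume) = ∫ x in ball x₀ r, ∫ y in ball x₀ r,
          (ψ x - ψ y) ^ 2 * ((w x + l) ^ α + (w y + l) ^ α) * η * K x y := by
    rw [hG1, integral_indicator (measurableSet_ball.prod measurableSet_ball)]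
    rw [setIntegral_prod]
    rwa [← integrable_indicator_iff (measurableSet_ball.prod measurableSet_ball)]
  have e2 : ∫ x, P x = ∫ x in ball x₀ r, (w x + l) ^ α * ψ x ^ 2 * η := by
    rw [hP, integral_indicator measurableSet_ball]
  rw [eG, e1, ← e2]
  have h9 : 2 * Λ * ((∫ p, G2 p ∂(volume.prod volume)) + ∫ p, G2 p ∂(volume.prod volume)) ≤
    2 * Λ * ((S1 + S2 / l) * (∫ x, P x) + (S1 + S2 / l) * ∫ x, P x) := by gcongr
  refine (add_le_add_right h9 _).trans (le_of_eq ?_)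
  generalize (∫ x in ball x₀ r, ∫ y in ball x₀ r,
          (ψ x - ψ y) ^ 2 * ((w x + l) ^ α + (w y + l) ^ α) * η * K x y) = J0
  generalize (∫ x, P x) = P0
  field_simp
  ring

lemma primitive_contDiff {f : ℝ → ℝ} (hf : ContDiff ℝ (⊤ : ℕ∞) f) (c : ℝ) :
    ContDiff ℝ (⊤ : ℕ∞) (fun t => ∫ z in c..t, f z) ∧
    ∀ t, HasDerivAt (fun t => ∫ z in c..t, f z) (f t) t := by
  have hd : ∀ t, HasDerivAt (fun t => ∫ z in c..t, f z) (f t) t := fun t =>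
    hf.continuous.integral_hasStrictDerivAt c t |>.hasDerivAt
  refine ⟨?_, hd⟩
  rw [contDiff_infty_iff_deriv]
  refine ⟨fun t => (hd t).differentiableAt, ?_⟩
  have : deriv (fun t => ∫ z in c..t, f z) = f := funext fun t => (hd t).deriv
  rw [this]; exact hf

lemma exists_h : ∃ h h' : ℝ → ℝ, ContDiff ℝ (⊤ : ℕ∞) h ∧ (∀ y, HasDerivAt h (h' y) y) ∧
    (∀ y ≤ 1 / 4, h y = 0) ∧ (∀ y, 0 ≤ y → 0 ≤ h y ∧ h y ≤ 2 * y) ∧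
    (∀ y, 0 ≤ h' y ∧ h' y ≤ 2) ∧ 1 ≤ h 1 := by
  set f : ℝ → ℝ := fun z => 2 * Real.smoothTransition (4 * z - 1) with hf
  have hfs : ContDiff ℝ (⊤ : ℕ∞) f := by
    have := Real.smoothTransition.contDiff (n := ((⊤ : ℕ∞)))
    exact contDiff_const.mul (this.comp (by fun_prop))
  have hf0 : ∀ z, 0 ≤ f z := fun z => by
    have := Real.smoothTransition.nonneg (4 * z - 1); simp only [hf]; linarith
  have hf2 : ∀ z, f z ≤ 2 := fun z => by
    have := Real.smoothTransition.le_one (4 * z - 1); simp only [hf]; linarith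
  obtain ⟨h1, h2⟩ := primitive_contDiff hfs 0
  have hint : ∀ a b, IntervalIntegrable f volume a b := fun a b =>
    hfs.continuous.intervalIntegrable a b
  refine ⟨_, f, h1, h2, ?_, ?_, fun y => ⟨hf0 y, hf2 y⟩, ?_⟩
  · intro y hy
    rw [intervalIntegral.integral_congr (g := fun _ => 0)]
    · simp
    · intro z hz
      simp only [hf]
      rw [Real.smoothTransition.zero_of_nonpos, mul_zero]
      have : z ≤ max 0 y := (mem_uIcc.1 hz).elim (fun h => h.2.trans (le_max_right _ _))
        (fun h => h.2.trans (le_max_left _ _))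
      have : max 0 y ≤ 1 / 4 := max_le (by norm_num) hy
      linarith
  · intro y hy
    refine ⟨intervalIntegral.integral_nonneg hy fun z _ => hf0 z, ?_⟩
    have := intervalIntegral.integral_mono_on hy (hint 0 y)
      (intervalIntegrable_const (c := (2 : ℝ))) (fun z _ => hf2 z)
    simpa [mul_comm] using this
  · rw [← intervalIntegral.integral_add_adjacent_intervals (hint 0 (1/2)) (hint (1/2) 1)]
    have e1 : 0 ≤ ∫ z in (0 : ℝ)..(1/2), f z :=
      intervalIntegral.integral_nonneg (by norm_num) fun z _ => hf0 z
    have e2 : ∫ z in (1/2 : ℝ)..1, f z = ∫ z in (1/2 : ℝ)..1, 2 := by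
      apply intervalIntegral.integral_congr
      intro z hz
      rw [uIcc_of_le (by norm_num)] at hz
      simp only [hf]
      rw [Real.smoothTransition.one_of_one_le (by linarith [hz.1]), mul_one]
    rw [e2]
    norm_num at *
    linarith

lemma exists_cutoff {τ τ₁ τ₂ t₁ ε : ℝ} (hε : 0 < ε) (h1 : τ₁ < t₁ - ε) (h2 : t₁ + ε < τ₂)
    (η : ℝ → ℝ) (hηs : ContDiff ℝ (⊤ : ℕ∞) η) (hη0 : ∀ t, 0 ≤ η t)
    (hη1 : ∀ t, τ₁ ≤ t → t ≤ τ₂ → η t = 1) (hη2 : ∀ t, τ₂ + τ ≤ t → η t = 0) :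
    ∃ θ g : ℝ → ℝ, ContDiff ℝ (⊤ : ℕ∞) θ ∧ HasCompactSupport θ ∧
      tsupport θ ⊆ Ioo τ₁ (τ₂ + τ) ∧ (∀ t, 0 ≤ θ t) ∧ (∀ t, θ t ≤ 2 * η t) ∧
      Continuous g ∧ (∀ t, 0 ≤ g t) ∧ (∀ t, t ∉ ball t₁ ε → g t = 0) ∧ ∫ t, g t = 1 ∧
      ∀ t, g t - 2 * |deriv η t| ≤ deriv θ t := by
  obtain ⟨h, h', hhs, hhd, hh0, hh2, hh', hh1⟩ := exists_h
  let f : ContDiffBump t₁ := ⟨ε / 2, ε, by linarith, by linarith⟩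
  set g : ℝ → ℝ := f.normed volume with hg
  have hgs : ContDiff ℝ (⊤ : ℕ∞) g := f.contDiff_normed
  have hg0 : ∀ t, 0 ≤ g t := fun t => f.nonneg_normed t
  have hgI : ∫ t, g t = 1 := f.integral_normed
  have hgint : Integrable g := f.integrable_normed
  have hgz : ∀ t, t ∉ ball t₁ ε → g t = 0 := by
    intro t ht
    have : t ∉ Function.support g := by rw [hg, f.support_normed_eq]; exact ht
    simpa using this
  obtain ⟨hχs, hχd⟩ := primitive_contDiff hgs (t₁ - ε)
  set χ : ℝ → ℝ := fun t => ∫ z in (t₁ - ε)..t, g z with hχ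
  have hχz : ∀ t ≤ t₁ - ε, χ t = 0 := by
    intro t ht
    simp only [hχ]
    rw [intervalIntegral.integral_congr (g := fun _ => 0)]
    · simp
    · intro z hz
      rw [uIcc_of_ge ht] at hz
      apply hgz
      rw [Real.ball_eq_Ioo]
      intro hh; linarith [hh.1, hz.2]
  have hχ0 : ∀ t, 0 ≤ χ t := by
    intro t
    rcases le_total t (t₁ - ε) with ht | ht
    · exact (hχz t ht).ge
    · exact intervalIntegral.integral_nonneg ht fun z _ => hg0 z
  have hχ1 : ∀ t, χ t ≤ 1 := by
    intro t
    rcases le_total t (t₁ - ε) with ht | ht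
    · rw [hχz t ht]; norm_num
    · simp only [hχ]
      rw [intervalIntegral.integral_of_le ht, ← hgI]
      exact setIntegral_le_integral hgint (Filter.Eventually.of_forall hg0)
  -- η is small near the right end
  have hev : ∀ᶠ t in nhds (τ₂ + τ), η t < 1 / 4 := by
    have := hηs.continuous.tendsto (τ₂ + τ)
    rw [hη2 _ le_rfl] at this
    exact this.eventually (gt_mem_nhds (by norm_num))
  obtain ⟨e, he, hball⟩ := Metric.eventually_nhds_iff.1 hev
  have hzero : ∀ t, τ₂ + τ - e / 2 ≤ t → h (η t) = 0 := by
    intro t ht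
    apply hh0
    rcases le_total (τ₂ + τ) t with h3 | h3
    · rw [hη2 t h3]; norm_num
    · refine (hball ?_).le
      rw [Real.dist_eq, abs_lt]
      constructor <;> linarith
  set θ : ℝ → ℝ := fun t => h (η t) * χ t with hθ
  have hsub : tsupport θ ⊆ Icc (t₁ - ε) (τ₂ + τ - e / 2) := by
    apply closure_minimal _ isClosed_Icc
    intro t ht
    rw [Function.mem_support] at ht
    by_contra hcon
    rw [mem_Icc, not_and_or, not_le, not_le] at hcon
    apply ht
    rcases hcon with h3 | h3
    · simp only [hθ]; rw [hχz t h3.le, mul_zero]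
    · simp only [hθ]; rw [hzero t h3.le, zero_mul]
  refine ⟨θ, g, (hhs.comp hηs).mul hχs, ?_, ?_, ?_, ?_, hgs.continuous, hg0, hgz, hgI, ?_⟩
  · exact isCompact_Icc.of_isClosed_subset (isClosed_tsupport _) hsub
  · refine hsub.trans fun t ht => ⟨by linarith [ht.1], by linarith [ht.2]⟩
  · intro t; exact mul_nonneg (hh2 _ (hη0 t)).1 (hχ0 t)
  · intro t
    have h3 := hh2 _ (hη0 t)
    exact (mul_le_of_le_one_right h3.1 (hχ1 t)).trans h3.2
  · intro t
    have hηd : HasDerivAt η (deriv η t) t :=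
      ((hηs.differentiable (by simp)) t).hasDerivAt
    have hd : HasDerivAt θ (h' (η t) * deriv η t * χ t + h (η t) * g t) t :=
      ((hhd (η t)).comp t hηd).mul (hχd t)
    rw [hd.deriv]
    have a1 : g t ≤ h (η t) * g t := by
      by_cases ht : t ∈ ball t₁ ε
      · rw [Real.ball_eq_Ioo] at ht
        rw [hη1 t (by linarith [ht.1]) (by linarith [ht.2])]
        exact le_mul_of_one_le_left (hg0 t) hh1
      · rw [hgz t ht]; simp
    have a2 : |h' (η t) * deriv η t * χ t| ≤ 2 * |deriv η t| := by
      rw [abs_mul, abs_mul, abs_of_nonneg (hh' _).1, abs_of_nonneg (hχ0 t)]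
      have := (hh' (η t)).2
      have := hχ1 t
      have := hχ0 t
      have := abs_nonneg (deriv η t)
      calc _ ≤ 2 * |deriv η t| * 1 := by gcongr
        _ = _ := by ring
    have := (abs_le.1 a2).1
    linarith

lemma contDiff_of_tsupp {F : Type*} [NormedAddCommGroup F] [NormedSpace ℝ F] {f : F → ℝ}
    (h : ∀ x ∈ tsupport f, ContDiffAt ℝ (⊤ : ℕ∞) f x) : ContDiff ℝ (⊤ : ℕ∞) f := by
  rw [contDiff_iff_contDiffAt]
  intro x
  by_cases hx : x ∈ tsupport f
  · exact h x hx
  · have h0 : f =ᶠ[nhds x] fun _ => 0 := notMem_tsupport_iff_eventuallyEq.1 hx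
    exact contDiffAt_const.congr_of_eventuallyEq h0

lemma mul_cutoff {f θ : ℝ → ℝ} {a b : ℝ} (hf : ContDiffOn ℝ (⊤ : ℕ∞) f (Ioo a b))
    (hθ : ContDiff ℝ (⊤ : ℕ∞) θ) (hc : HasCompactSupport θ) (hs : tsupport θ ⊆ Ioo a b) :
    ContDiff ℝ (⊤ : ℕ∞) (fun t => f t * θ t) ∧ HasCompactSupport (fun t => f t * θ t) := by
  refine ⟨?_, hc.mul_left⟩
  apply contDiff_of_tsupp
  intro t ht
  have h1 : t ∈ Ioo a b := hs (tsupport_mul_subset_right ht)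
  exact (hf.contDiffAt (isOpen_Ioo.mem_nhds h1)).mul hθ.contDiffAt

lemma test_fun (N : ℕ) {T a b R r l α : ℝ} {Ω : Set (E N)} (hΩo : IsOpen Ω) (u : E N → ℝ → ℝ)
    (hus : ContDiffOn ℝ (⊤ : ℕ∞) (fun p : E N × ℝ => u p.1 p.2) (Ω ×ˢ Ioo 0 T)) (x₀ : E N)
    (hsubx : ball x₀ R ⊆ Ω) (hsubt : Ioo a b ⊆ Ioo 0 T)
    (hupos : ∀ x ∈ ball x₀ R, ∀ t ∈ Ioo a b, 0 ≤ u x t) (hrR : r < R) (hl : 0 < l)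
    (ψ : E N → ℝ) (hψs : ContDiff ℝ (⊤ : ℕ∞) ψ) (hψc : HasCompactSupport ψ)
    (hψsupp : tsupport ψ ⊆ ball x₀ r) (θ : ℝ → ℝ) (hθs : ContDiff ℝ (⊤ : ℕ∞) θ)
    (hθc : HasCompactSupport θ) (hθsupp : tsupport θ ⊆ Ioo a b) (hθ0 : ∀ t, 0 ≤ θ t) :
    ContDiff ℝ (⊤ : ℕ∞) (fun p : E N × ℝ => (u p.1 p.2 + l) ^ (α - 1) * ψ p.1 ^ 2 * θ p.2) ∧
    HasCompactSupport (fun p : E N × ℝ => (u p.1 p.2 + l) ^ (α - 1) * ψ p.1 ^ 2 * θ p.2) ∧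
    tsupport (fun p : E N × ℝ => (u p.1 p.2 + l) ^ (α - 1) * ψ p.1 ^ 2 * θ p.2) ⊆ Ω ×ˢ Ioo 0 T ∧
    (∀ x t, 0 ≤ (u x t + l) ^ (α - 1) * ψ x ^ 2 * θ t) := by
  have hsub : tsupport (fun p : E N × ℝ => (u p.1 p.2 + l) ^ (α - 1) * ψ p.1 ^ 2 * θ p.2) ⊆
      tsupport ψ ×ˢ tsupport θ := by
    apply closure_minimal _ ((isClosed_tsupport ψ).prod (isClosed_tsupport θ))
    rintro ⟨x, t⟩ h
    rw [Function.mem_support] at h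
    constructor
    · apply subset_tsupport; rw [Function.mem_support]; intro h0; simp only at h0; apply h; simp [h0]
    · apply subset_tsupport; rw [Function.mem_support]; intro h0; simp only at h0; apply h; simp [h0]
  have hrb : ball x₀ r ⊆ ball x₀ R := ball_subset_ball hrR.le
  refine ⟨?_, ?_, ?_, ?_⟩
  · apply contDiff_of_tsupp
    rintro ⟨x, t⟩ hp
    obtain ⟨hx, ht⟩ := hsub hp
    simp only at hx ht
    have hx' := hrb (hψsupp hx)
    have ht' := hθsupp ht
    have hu : ContDiffAt ℝ (⊤ : ℕ∞) (fun p : E N × ℝ => u p.1 p.2) (x, t) :=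
      hus.contDiffAt ((hΩo.prod isOpen_Ioo).mem_nhds ⟨hsubx hx', hsubt ht'⟩)
    have h1 := hupos x hx' t ht'
    refine ((ContDiffAt.rpow_const_of_ne (hu.add contDiffAt_const) ?_).mul ?_).mul ?_
    · simp only; positivity
    · exact ((hψs.comp contDiff_fst).pow 2).contDiffAt
    · exact (hθs.comp contDiff_snd).contDiffAt
  · exact (hψc.isCompact.prod hθc.isCompact).of_isClosed_subset (isClosed_tsupport _) hsub
  · exact hsub.trans (prod_mono (hψsupp.trans (hrb.trans hsubx)) (hθsupp.trans hsubt))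
  · intro x t
    by_cases hx : x ∈ tsupport ψ
    swap
    · simp [image_eq_zero_of_notMem_tsupport hx]
    by_cases ht : t ∈ tsupport θ
    swap
    · simp [image_eq_zero_of_notMem_tsupport ht]
    have h1 := hupos x (hrb (hψsupp hx)) t (hθsupp ht)
    have h2 := hθ0 t
    positivity

lemma grad_est (N : ℕ) {T a b R r l α : ℝ} {Ω : Set (E N)} (hΩo : IsOpen Ω) (u : E N → ℝ → ℝ)
    (hus : ContDiffOn ℝ (⊤ : ℕ∞) (fun p : E N × ℝ => u p.1 p.2) (Ω ×ˢ Ioo 0 T)) (x₀ : E N)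
    (hsubx : ball x₀ R ⊆ Ω) (hsubt : Ioo a b ⊆ Ioo 0 T)
    (hupos : ∀ x ∈ ball x₀ R, ∀ t ∈ Ioo a b, 0 ≤ u x t) (hrR : r < R) (hl : 0 < l)
    (hα : α < 1)
    (ψ : E N → ℝ) (hψs : ContDiff ℝ (⊤ : ℕ∞) ψ)
    (hψsupp : tsupport ψ ⊆ ball x₀ r) {t : ℝ} (ht : t ∈ Ioo a b) {θ η : ℝ} (hθ : 0 ≤ θ)
    (hθη : θ ≤ 2 * η) (x : E N) :
    ⟪gradient (fun y => u y t) x, gradient (fun y => (u y t + l) ^ (α - 1) * ψ y ^ 2 * θ) x⟫ ≤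
      (ball x₀ r).indicator (fun x => 2 * (1 / (1 - α) * ((u x t + l) ^ α * ‖gradient ψ x‖ ^ 2 * η))) x := by
  have hrb : ball x₀ r ⊆ ball x₀ R := ball_subset_ball hrR.le
  have hβ : 0 < 1 - α := by linarith
  have hη : 0 ≤ η := by linarith
  by_cases hx : x ∈ tsupport ψ
  · have hx' := hrb (hψsupp hx)
    rw [indicator_of_mem (hψsupp hx)]
    have hu : ContDiffAt ℝ (⊤ : ℕ∞) (fun p : E N × ℝ => u p.1 p.2) (x, t) :=
      hus.contDiffAt ((hΩo.prod isOpen_Ioo).mem_nhds ⟨hsubx hx', hsubt ht⟩)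
    have hu1 : ContDiffAt ℝ (⊤ : ℕ∞) (fun y : E N => u y t) x :=
      hu.comp x (contDiffAt_id.prodMk contDiffAt_const)
    have hud : DifferentiableAt ℝ (fun y : E N => u y t) x := hu1.differentiableAt (by simp)
    have hψd : DifferentiableAt ℝ ψ x := hψs.contDiffAt.differentiableAt (by simp)
    have hv : 0 < u x t + l := by have := hupos x hx' t ht; linarith
    have f1 := hud.hasFDerivAt
    have f2 := hψd.hasFDerivAt
    have f3 := (((f1.add_const l).rpow_const (p := α - 1) (Or.inl hv.ne')).mul (f2.pow 2)).mul_const θ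
    have e : gradient (fun y => (u y t + l) ^ (α - 1) * ψ y ^ 2 * θ) x =
        θ • ((ψ x ^ 2 * ((α - 1) * (u x t + l) ^ (α - 2))) • gradient (fun y => u y t) x +
          ((u x t + l) ^ (α - 1) * (2 * ψ x)) • gradient ψ x) := by
      have h4 : fderiv ℝ (fun y => (u y t + l) ^ (α - 1) * ψ y ^ 2 * θ) x = _ := f3.fderiv
      unfold gradient
      rw [h4]
      simp only [map_smul, map_add, smul_smul, smul_add]
      rw [add_comm]
      have : α - 1 - 1 = α - 2 := by ring
      rw [this]
      congr 2
      all_goals (simp; try ring)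
    rw [e, inner_smul_right]
    have h5 := grad_alg (gradient (fun y => u y t) x) (gradient ψ x) (p := ψ x) hv hα
    have h6 : 0 ≤ 1 / (1 - α) * ((u x t + l) ^ α * ‖gradient ψ x‖ ^ 2) := by positivity
    calc _ ≤ θ * (1 / (1 - α) * ((u x t + l) ^ α * ‖gradient ψ x‖ ^ 2)) := by gcongr
      _ ≤ (2 * η) * (1 / (1 - α) * ((u x t + l) ^ α * ‖gradient ψ x‖ ^ 2)) := by gcongr
      _ = _ := by ring
  · have h0 : (fun y => (u y t + l) ^ (α - 1) * ψ y ^ 2 * θ) =ᶠ[nhds x] fun _ => 0 := by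
      filter_upwards [notMem_tsupport_iff_eventuallyEq.1 hx] with y hy
      simp [hy]
    have e : gradient (fun y => (u y t + l) ^ (α - 1) * ψ y ^ 2 * θ) x = 0 := by
      unfold gradient
      rw [h0.fderiv_eq]; simp
    rw [e, inner_zero_right]
    apply indicator_nonneg
    intro y hy
    have hv : 0 < u y t + l := by have := hupos y (hrb hy) t ht; linarith
    positivity

lemma time_term (N : ℕ) {T a b R r l α M : ℝ} {Ω : Set (E N)} (hΩo : IsOpen Ω) (u : E N → ℝ → ℝ)
    (hum : Measurable (fun p : E N × ℝ => u p.1 p.2))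
    (huM : ∀ x t, t ∈ Ioo 0 T → |u x t| ≤ M)
    (hus : ContDiffOn ℝ (⊤ : ℕ∞) (fun p : E N × ℝ => u p.1 p.2) (Ω ×ˢ Ioo 0 T)) (x₀ : E N)
    (hsubx : ball x₀ R ⊆ Ω) (hsubt : Ioo a b ⊆ Ioo 0 T)
    (hupos : ∀ x ∈ ball x₀ R, ∀ t ∈ Ioo a b, 0 ≤ u x t) (hrR : r < R) (hl : 0 < l)
    (hα : 0 < α)
    (ψ : E N → ℝ) (hψs : ContDiff ℝ (⊤ : ℕ∞) ψ) (hψc : HasCompactSupport ψ)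
    (hψsupp : tsupport ψ ⊆ ball x₀ r) (θ : ℝ → ℝ) (hθs : ContDiff ℝ (⊤ : ℕ∞) θ)
    (hθc : HasCompactSupport θ) (hθsupp : tsupport θ ⊆ Ioo a b) (hθ0 : ∀ t, 0 ≤ θ t) :
    IntegrableOn (fun p : ℝ × E N => (u p.2 p.1 + l) ^ α * ψ p.2 ^ 2 * deriv θ p.1)
      (Ioo a b ×ˢ ball x₀ r) ((volume : Measure ℝ).prod (volume : Measure (E N))) ∧
    ∫ t in Ioo 0 T, ∫ x in Ω, u x t * deriv (fun τ => (u x τ + l) ^ (α - 1) * ψ x ^ 2 * θ τ) t =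
      1 / α * ∫ t in Ioo a b, ∫ x in ball x₀ r, (u x t + l) ^ α * ψ x ^ 2 * deriv θ t := by
  have hrb : ball x₀ r ⊆ ball x₀ R := ball_subset_ball hrR.le
  obtain ⟨hφs, hφc, hφsupp, hφ0⟩ := test_fun N (α := α) hΩo u hus x₀ hsubx hsubt hupos hrR hl ψ hψs
    hψc hψsupp θ hθs hθc hθsupp hθ0
  have hθ's : ContDiff ℝ (⊤ : ℕ∞) (deriv θ) := (contDiff_infty_iff_deriv.1 hθs).2
  have hθ'c : HasCompactSupport (deriv θ) := hθc.deriv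
  have hθ'supp : tsupport (deriv θ) ⊆ Ioo a b := (tsupport_deriv_subset (𝕜 := ℝ) (f := θ)).trans hθsupp
  -- integrability of Q
  have hQ : IntegrableOn (fun p : ℝ × E N => (u p.2 p.1 + l) ^ α * ψ p.2 ^ 2 * deriv θ p.1)
      (Ioo a b ×ˢ ball x₀ r) ((volume : Measure ℝ).prod (volume : Measure (E N))) := by
    obtain ⟨C1, hC1⟩ := hθ's.continuous.bounded_above_of_compact_support hθ'c
    obtain ⟨C2, hC2⟩ := hψs.continuous.bounded_above_of_compact_support hψc
    have hC10 := (norm_nonneg _).trans (hC1 0)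
    have hmeas : Measurable (fun p : ℝ × E N => u p.2 p.1) := hum.comp measurable_swap
    have hθm : Measurable (deriv θ) := hθ's.continuous.measurable
    have hψm : Measurable ψ := hψs.continuous.measurable
    refine IntegrableOn.of_bound (C := (M + l) ^ α * C2 ^ 2 * C1) ?_
      (Measurable.aestronglyMeasurable (by fun_prop)) ?_
    · rw [Measure.prod_prod]
      exact ENNReal.mul_lt_top (by simp) measure_ball_lt_top
    · filter_upwards [ae_restrict_mem (measurableSet_Ioo.prod measurableSet_ball)] with p hp
      obtain ⟨hp1, hp2⟩ := hp
      have h1 := hupos _ (hrb hp2) _ hp1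
      have h2 := (abs_le.1 (huM p.2 p.1 (hsubt hp1))).2
      rw [norm_mul, norm_mul, norm_pow]
      have h3 : ‖(u p.2 p.1 + l) ^ α‖ ≤ (M + l) ^ α := by
        rw [Real.norm_of_nonneg (by positivity)]
        exact Real.rpow_le_rpow (by positivity) (by linarith) hα.le
      have h30 := (norm_nonneg _).trans h3
      have h4 := hC1 p.1
      have h5 := hC2 p.2
      gcongr
  refine ⟨hQ, ?_⟩
  -- integrability of F
  set φ : E N × ℝ → ℝ := fun p => (u p.1 p.2 + l) ^ (α - 1) * ψ p.1 ^ 2 * θ p.2 with hφ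
  have hder : ∀ x t, deriv (fun τ => (u x τ + l) ^ (α - 1) * ψ x ^ 2 * θ τ) t =
      fderiv ℝ φ (x, t) (0, 1) := by
    intro x t
    have h1 : HasFDerivAt φ (fderiv ℝ φ (x, t)) (x, t) :=
      ((hφs.differentiable (by simp)) (x, t)).hasFDerivAt
    have h2 : HasDerivAt (fun τ : ℝ => ((x, τ) : E N × ℝ)) (0, 1) t :=
      (hasDerivAt_const t x).prodMk (hasDerivAt_id t)
    exact (h1.comp_hasDerivAt t h2).deriv
  have hF : IntegrableOn (fun p : ℝ × E N => u p.2 p.1 *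
      deriv (fun τ => (u p.2 τ + l) ^ (α - 1) * ψ p.2 ^ 2 * θ τ) p.1)
      (Ioo 0 T ×ˢ Ω) ((volume : Measure ℝ).prod (volume : Measure (E N))) := by
    have hc : Continuous (fun p : E N × ℝ => fderiv ℝ φ p (0, 1)) :=
      (hφs.continuous_fderiv (by simp)).clm_apply continuous_const
    have hcs : HasCompactSupport (fun p : E N × ℝ => fderiv ℝ φ p (0, 1)) :=
      hφc.fderiv_apply (𝕜 := ℝ) (0, 1)
    have hi : Integrable (fun p : E N × ℝ => fderiv ℝ φ p (0, 1))
      ((volume : Measure (E N)).prod (volume : Measure ℝ)) := hc.integrable_of_hasCompactSupport hcs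
    have hi2 := hi.swap
    simp only [hder]
    refine Integrable.bdd_mul (c := M) (hi2.integrableOn (s := Ioo 0 T ×ˢ Ω)) ?_ ?_
    · exact (hum.comp measurable_swap).aestronglyMeasurable
    · filter_upwards [ae_restrict_mem (measurableSet_Ioo.prod hΩo.measurableSet)] with p hp
      exact huM p.2 p.1 hp.1
  unfold IntegrableOn at hF hQ
  rw [← Measure.prod_restrict] at hF hQ
  have sF := integral_integral_swap (f := fun t x => u x t *
    deriv (fun τ => (u x τ + l) ^ (α - 1) * ψ x ^ 2 * θ τ) t) hF
  have sQ := integral_integral_swap (f := fun t x => (u x t + l) ^ α * ψ x ^ 2 * deriv θ t) hQ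
  rw [sF, sQ]
  rw [← integral_const_mul]
  have hstep : ∀ x, ∫ t in Ioo 0 T, u x t * deriv (fun τ => (u x τ + l) ^ (α - 1) * ψ x ^ 2 * θ τ) t
      = (ball x₀ r).indicator (fun x => 1 / α * ∫ t in Ioo a b, (u x t + l) ^ α * ψ x ^ 2 * deriv θ t) x := by
    intro x
    by_cases hx : x ∈ ball x₀ r
    swap
    · rw [indicator_of_notMem hx]
      have : ψ x = 0 := image_eq_zero_of_notMem_tsupport fun h => hx (hψsupp h)
      simp [this]
    rw [indicator_of_mem hx, ← integral_const_mul]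
    have hu1 : ContDiffOn ℝ (⊤ : ℕ∞) (fun t => u x t) (Ioo a b) := by
      have : ContDiffOn ℝ (⊤ : ℕ∞) (fun t : ℝ => ((x, t) : E N × ℝ)) (Ioo a b) := by fun_prop
      exact hus.comp this fun t ht => ⟨hsubx (hrb hx), hsubt ht⟩
    have hv : ∀ t ∈ Ioo a b, 0 < u x t + l := fun t ht => by
      have := hupos x (hrb hx) t ht; linarith
    have hvp : ∀ p : ℝ, ContDiffOn ℝ (⊤ : ℕ∞) (fun t => (u x t + l) ^ p) (Ioo a b) := fun p =>
      (hu1.add contDiffOn_const).rpow_const_of_ne fun t ht => (hv t ht).ne'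
    obtain ⟨hD1, hD2⟩ := mul_cutoff
      (((hu1.mul (hvp (α - 1))).sub ((contDiffOn_const (c := 1 / α)).mul (hvp α))).mul
        (contDiffOn_const (c := ψ x ^ 2))) hθs hθc hθsupp
    obtain ⟨hQ1, hQ2⟩ := mul_cutoff
      ((contDiffOn_const (c := 1 / α)).mul ((hvp α).mul (contDiffOn_const (c := ψ x ^ 2))))
        hθ's hθ'c hθ'supp
    set D : ℝ → ℝ := fun t => (u x t * (u x t + l) ^ (α - 1) - 1 / α * (u x t + l) ^ α) * ψ x ^ 2 * θ t with hD
    have hpt : ∀ t, u x t * deriv (fun τ => (u x τ + l) ^ (α - 1) * ψ x ^ 2 * θ τ) t =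
        deriv D t + 1 / α * ((u x t + l) ^ α * ψ x ^ 2) * deriv θ t := by
      intro t
      by_cases ht : t ∈ tsupport θ
      · have ht' := hθsupp ht
        have hvt := hv t ht'
        have d1 : HasDerivAt (fun t => u x t) (deriv (fun t => u x t) t) t :=
          ((hu1.contDiffAt (isOpen_Ioo.mem_nhds ht')).differentiableAt (by simp)).hasDerivAt
        have d2 : HasDerivAt θ (deriv θ t) t := ((hθs.differentiable (by simp)) t).hasDerivAt
        have d3 := (d1.add_const l).rpow_const (p := α - 1) (Or.inl hvt.ne')
        have d4 := (d1.add_const l).rpow_const (p := α) (Or.inl hvt.ne')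
        have d5 := (d3.mul_const (ψ x ^ 2)).mul d2
        have d6 := (((d1.mul d3).sub (d4.const_mul (1 / α))).mul_const (ψ x ^ 2)).mul d2
        have e5 : deriv (fun τ => (u x τ + l) ^ (α - 1) * ψ x ^ 2 * θ τ) t = _ := d5.deriv
        have e6 : deriv D t = _ := d6.deriv
        rw [e5, e6]
        simp only [Pi.mul_apply, Pi.sub_apply]
        field_simp
        ring
      · have h0 := notMem_tsupport_iff_eventuallyEq.1 ht
        have e1 : deriv (fun τ => (u x τ + l) ^ (α - 1) * ψ x ^ 2 * θ τ) t = 0 := by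
          have : (fun τ => (u x τ + l) ^ (α - 1) * ψ x ^ 2 * θ τ) =ᶠ[nhds t] fun _ => 0 := by
            filter_upwards [h0] with y hy; simp [hy]
          rw [this.deriv_eq]; simp
        have e2 : deriv D t = 0 := by
          have : D =ᶠ[nhds t] fun _ => 0 := by
            filter_upwards [h0] with y hy; simp [hD, hy]
          rw [this.deriv_eq]; simp
        have e3 : deriv θ t = 0 := by
          rw [h0.deriv_eq]; simp
        rw [e1, e2, e3]; simp
    have hDi : Integrable (deriv D) :=
      (hD1.continuous_deriv (by simp)).integrable_of_hasCompactSupport hD2.deriv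
    have hQi := hQ1.continuous.integrable_of_hasCompactSupport hQ2 (μ := volume)
    simp only [hpt]
    rw [integral_add hDi.integrableOn hQi.integrableOn]
    have z1 : ∫ t in Ioo 0 T, deriv D t = 0 := by
      rw [setIntegral_eq_integral_of_forall_compl_eq_zero]
      · exact integral_eq_zero_of_hasDerivAt_of_integrable
          (fun t => ((hD1.differentiable (by simp)) t).hasDerivAt) hDi
          (hD1.continuous.integrable_of_hasCompactSupport hD2)
      · intro t ht
        have ht' : t ∉ tsupport θ := fun h => ht (hsubt (hθsupp h))
        have h0 := notMem_tsupport_iff_eventuallyEq.1 ht'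
        have : D =ᶠ[nhds t] fun _ => 0 := by
          filter_upwards [h0] with y hy; simp [hD, hy]
        rw [this.deriv_eq]; simp
    rw [z1, zero_add]
    rw [setIntegral_eq_of_subset_of_forall_sdiff_eq_zero measurableSet_Ioo hsubt]
    · congr 1; ext t; ring
    · intro t ht
      have : deriv θ t = 0 := image_eq_zero_of_notMem_tsupport fun h => ht.2 (hθ'supp h)
      rw [this, mul_zero]
  simp only [hstep]
  rw [setIntegral_indicator measurableSet_ball, inter_eq_right.2 (hrb.trans hsubx)]

lemma slice_int (N : ℕ) (x₀ : E N) {r a b C : ℝ} (W : E N → ℝ → ℝ)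
    (hW : Measurable fun p : E N × ℝ => W p.1 p.2)
    (h0 : ∀ x ∈ ball x₀ r, ∀ t ∈ Ioo a b, 0 ≤ W x t)
    (hC : ∀ x ∈ ball x₀ r, ∀ t ∈ Ioo a b, W x t ≤ C) :
    IntegrableOn (fun t => ∫ x in ball x₀ r, W x t) (Ioo a b) ∧
    (∀ t ∈ Ioo a b, 0 ≤ ∫ x in ball x₀ r, W x t) ∧
    (∀ t ∈ Ioo a b, IntegrableOn (fun x => W x t) (ball x₀ r)) := by
  refine ⟨?_, fun t ht => setIntegral_nonneg measurableSet_ball fun x hx => h0 x hx t ht, ?_⟩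
  · have hI : IntegrableOn (fun p : ℝ × E N => W p.2 p.1) (Ioo a b ×ˢ ball x₀ r)
        ((volume : Measure ℝ).prod (volume : Measure (E N))) := by
      refine IntegrableOn.of_bound (C := C) ?_
        (hW.comp measurable_swap).aestronglyMeasurable ?_
      · rw [Measure.prod_prod]
        exact ENNReal.mul_lt_top (by simp) measure_ball_lt_top
      · filter_upwards [ae_restrict_mem (measurableSet_Ioo.prod measurableSet_ball)] with p hp
        rw [Real.norm_of_nonneg (h0 _ hp.2 _ hp.1)]
        exact hC _ hp.2 _ hp.1
    unfold IntegrableOn at hI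
    rw [← Measure.prod_restrict] at hI
    exact hI.integral_prod_left
  · intro t ht
    refine IntegrableOn.of_bound (C := C) measure_ball_lt_top ?_ ?_
    · exact (hW.comp (measurable_id.prodMk measurable_const)).aestronglyMeasurable
    · filter_upwards [ae_restrict_mem measurableSet_ball] with x hx
      rw [Real.norm_of_nonneg (h0 _ hx _ ht)]
      exact hC _ hx _ ht

lemma J_int (N : ℕ) (hN : 2 ≤ N) {s Λ T : ℝ} (hs : s ∈ Ioo (0 : ℝ) 1) (hΛ : 1 ≤ Λ)
    (K : E N → E N → ℝ → ℝ) (hK : KernelOK N s Λ T K) (x₀ : E N) {r a b C Cη L : ℝ} (hr : 0 < r)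
    (hsubt : Ioo a b ⊆ Ioo 0 T)
    (ψ : E N → ℝ) (hψm : Measurable ψ) (hL : ∀ x y, |ψ x - ψ y| ≤ L * ‖x - y‖)
    (V : E N → ℝ → ℝ)
    (hV : Measurable fun p : E N × ℝ => V p.1 p.2)
    (h0 : ∀ x ∈ ball x₀ r, ∀ t ∈ Ioo a b, 0 ≤ V x t)
    (hC : ∀ x ∈ ball x₀ r, ∀ t ∈ Ioo a b, V x t ≤ C) (η : ℝ → ℝ) (hη : Measurable η)
    (hη0 : ∀ t, 0 ≤ η t) (hηC : ∀ t ∈ Ioo a b, η t ≤ Cη) :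
    IntegrableOn (fun t => ∫ x in ball x₀ r, ∫ y in ball x₀ r,
      (ψ x - ψ y) ^ 2 * (V x t + V y t) * η t * K x y t) (Ioo a b) ∧
    (∀ t ∈ Ioo a b, 0 ≤ ∫ x in ball x₀ r, ∫ y in ball x₀ r,
      (ψ x - ψ y) ^ 2 * (V x t + V y t) * η t * K x y t) := by
  obtain ⟨hKm, hKs, hKb⟩ := hK
  have hKb' : ∀ t ∈ Ioo a b, ∀ x y : E N, x ≠ y → 0 ≤ K x y t ∧
      K x y t ≤ Λ * ‖x - y‖ ^ (-((N : ℝ) + 2 * s)) := fun t ht x y hxy =>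
    ⟨le_trans (by positivity) (hKb x y hxy t (hsubt ht)).1, (hKb x y hxy t (hsubt ht)).2⟩
  have hKm' : ∀ t, Measurable (fun p : E N × E N => K p.1 p.2 t) := fun t =>
    hKm.comp (measurable_fst.prodMk (measurable_snd.prodMk measurable_const))
  have hVt : ∀ t, Measurable fun x => V x t := fun t =>
    hV.comp (measurable_id.prodMk measurable_const)
  have key := fun t (ht : t ∈ Ioo a b) => near_integrable N hN hs.2 hΛ (fun x y => K x y t) (hKm' t)
    (hKb' t ht) x₀ hr ψ hψm hL (fun x => V x t) (hVt t) (fun x hx => h0 x hx t ht)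
    (fun x hx => hC x hx t ht) (η t) (hη0 t)
  have hconv : ∀ t, ∫ x in ball x₀ r, ∫ y in ball x₀ r,
      (ψ x - ψ y) ^ 2 * (V x t + V y t) * η t * K x y t = ∫ x, ∫ y,
      (ball x₀ r ×ˢ ball x₀ r).indicator
      (fun p : E N × E N => (ψ p.1 - ψ p.2) ^ 2 * (V p.1 t + V p.2 t) * η t * K p.1 p.2 t) (x, y) := by
    intro t
    rw [← integral_indicator measurableSet_ball]
    congr 1; ext x
    by_cases hx : x ∈ ball x₀ r
    · rw [indicator_of_mem hx, ← integral_indicator measurableSet_ball]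
      congr 1; ext y
      by_cases hy : y ∈ ball x₀ r
      · rw [indicator_of_mem hy, indicator_of_mem (mk_mem_prod hx hy)]
      · rw [indicator_of_notMem hy, indicator_of_notMem (fun h => hy h.2)]
    · rw [indicator_of_notMem hx]
      symm
      rw [integral_eq_zero_of_ae]
      refine Filter.Eventually.of_forall fun y => ?_
      exact indicator_of_notMem (fun h => hx h.1) _
  have hnn : ∀ t ∈ Ioo a b, 0 ≤ ∫ x in ball x₀ r, ∫ y in ball x₀ r,
      (ψ x - ψ y) ^ 2 * (V x t + V y t) * η t * K x y t := by
    intro t ht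
    rw [hconv]
    exact integral_nonneg fun x => integral_nonneg fun y => (key t ht).2.1 _
  refine ⟨?_, hnn⟩
  set kn : ℝ := ∫ z : E N, (if ‖z‖ < 2 * r then ‖z‖ ^ (2 - ((N : ℝ) + 2 * s)) else 0) with hkn
  have hkn0 : 0 ≤ kn := integral_nonneg fun z => by
    simp only [Pi.zero_apply]; split_ifs <;> positivity
  have hkni := k_near N hN hs.2 (ρ := 2 * r) (by positivity)
  refine IntegrableOn.of_bound (C := ∫ x, (ball x₀ r).indicator
    (fun _ => L ^ 2 * (2 * C) * Cη * Λ * kn) x) (by simp) ?_ ?_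
  · apply StronglyMeasurable.aestronglyMeasurable
    have m3 : Measurable fun q : (ℝ × E N) × E N => (ψ q.1.2 - ψ q.2) ^ 2 *
        (V q.1.2 q.1.1 + V q.2 q.1.1) * η q.1.1 * K q.1.2 q.2 q.1.1 := by
      have k1 : Measurable fun q : (ℝ × E N) × E N => V q.1.2 q.1.1 :=
        hV.comp (by fun_prop : Measurable fun q : (ℝ × E N) × E N => (q.1.2, q.1.1))
      have k2 : Measurable fun q : (ℝ × E N) × E N => V q.2 q.1.1 :=
        hV.comp (by fun_prop : Measurable fun q : (ℝ × E N) × E N => (q.2, q.1.1))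
      have k3 : Measurable fun q : (ℝ × E N) × E N => K q.1.2 q.2 q.1.1 :=
        hKm.comp (by fun_prop : Measurable fun q : (ℝ × E N) × E N => (q.1.2, q.2, q.1.1))
      fun_prop
    have m2 := StronglyMeasurable.integral_prod_right'
      (ν := (volume : Measure (E N)).restrict (ball x₀ r)) m3.stronglyMeasurable
    exact StronglyMeasurable.integral_prod_right'
      (ν := (volume : Measure (E N)).restrict (ball x₀ r)) m2
  · filter_upwards [ae_restrict_mem measurableSet_Ioo] with t ht
    rw [Real.norm_of_nonneg (hnn t ht), hconv]
    obtain ⟨k1, k2, k3⟩ := key t ht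
    have hC0 : 0 ≤ C := (h0 x₀ (mem_ball_self hr) t ht).trans (hC x₀ (mem_ball_self hr) t ht)
    refine integral_mono k3.integral_prod_left ?_ ?_
    · exact (integrable_indicator_iff measurableSet_ball).2
        (integrableOn_const (measure_ball_lt_top.ne))
    · intro x
      calc _ ≤ ∫ y, (ball x₀ r).indicator (fun _ => L ^ 2 * (2 * C) * η t * Λ) x *
        (if ‖y - x‖ < 2 * r then ‖y - x‖ ^ (2 - ((N : ℝ) + 2 * s)) else 0) := by
            refine integral_le_trick (Filter.Eventually.of_forall fun y => k1 x y)
              (Filter.Eventually.of_forall fun y => (k2 (x, y)).trans (k1 x y)) ?_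
            exact (hkni.comp_sub_right x).const_mul _
        _ = (ball x₀ r).indicator (fun _ => L ^ 2 * (2 * C) * η t * Λ) x * kn := by
            rw [integral_const_mul, integral_sub_right_eq_self
              (fun z : E N => (if ‖z‖ < 2 * r then ‖z‖ ^ (2 - ((N : ℝ) + 2 * s)) else 0)) x]
        _ ≤ _ := by
            by_cases hx : x ∈ ball x₀ r
            · simp only [indicator_of_mem hx]
              have := hηC t ht
              gcongr
            · simp only [indicator_of_notMem hx]; simp

lemma core (N : ℕ) (hN : 2 ≤ N) {s Λ T : ℝ} (hs : s ∈ Ioo (0 : ℝ) 1) (hΛ : 1 ≤ Λ)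
    (Ω : Set (E N)) (hΩo : IsOpen Ω)
    (K : E N → E N → ℝ → ℝ) (hK : KernelOK N s Λ T K)
    (u : E N → ℝ → ℝ) (hu : IsWeakSupersolution N T K Ω u)
    (x₀ : E N) {R r a b l α : ℝ}
    (hsubx : ball x₀ R ⊆ Ω) (hsubt : Ioo a b ⊆ Ioo 0 T)
    (hupos : ∀ x ∈ ball x₀ R, ∀ t ∈ Ioo a b, 0 ≤ u x t)
    (hr : 0 < r) (hrR : r < R) (hl : 0 < l) (hα : α ∈ Ioo (0 : ℝ) 1)
    (ψ : E N → ℝ) (hψs : ContDiff ℝ (⊤ : ℕ∞) ψ) (hψc : HasCompactSupport ψ)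
    (hψsupp : tsupport ψ ⊆ ball x₀ r) {δ : ℝ} (hδ : 0 < δ)
    (hSδ : ∀ x ∈ tsupport ψ, ∀ y ∈ (ball x₀ r)ᶜ, δ ≤ ‖x - y‖)
    (η : ℝ → ℝ) (hηs : ContDiff ℝ (⊤ : ℕ∞) η) (hη0 : ∀ t, 0 ≤ η t)
    {S1 S2 : ℝ} (hS10 : 0 ≤ S1) (hS20 : 0 ≤ S2)
    (hS1 : ∀ x ∈ tsupport ψ, ∫ y in (ball x₀ r)ᶜ, ‖x - y‖ ^ (-((N : ℝ) + 2 * s)) ≤ S1)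
    (hS2 : ∀ᵐ t ∂(volume.restrict (Ioo a b)), ∀ x ∈ tsupport ψ,
      ∫ y in (ball x₀ R)ᶜ, max (-(u y t)) 0 * ‖x - y‖ ^ (-((N : ℝ) + 2 * s)) ≤ S2)
    (θ g : ℝ → ℝ) (hθs : ContDiff ℝ (⊤ : ℕ∞) θ)
    (hθc : HasCompactSupport θ) (hθsupp : tsupport θ ⊆ Ioo a b) (hθ0 : ∀ t, 0 ≤ θ t)
    (hθη : ∀ t, θ t ≤ 2 * η t) (hgc : Continuous g) (hg0 : ∀ t, 0 ≤ g t)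
    (hθ' : ∀ t, g t - 2 * |deriv η t| ≤ deriv θ t) :
    0 ≤ (∫ t in Ioo a b, ∫ x in ball x₀ r, ∫ y in ball x₀ r,
              (ψ x - ψ y) ^ 2 * ((u x t + l) ^ α + (u y t + l) ^ α) * η t * K x y t) ∧
    0 ≤ (∫ t in Ioo a b, ∫ x in ball x₀ r, (u x t + l) ^ α * ψ x ^ 2 * η t) ∧
    0 ≤ (∫ t in Ioo a b, ∫ x in ball x₀ r, (u x t + l) ^ α * ‖gradient ψ x‖ ^ 2 * η t) ∧
    (∫ t in Ioo a b, (∫ x in ball x₀ r, (u x t + l) ^ α * ψ x ^ 2) * g t) ≤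
      (2 * α) *
        (1 / (1 - α) *
            (∫ t in Ioo a b, ∫ x in ball x₀ r, ∫ y in ball x₀ r,
              (ψ x - ψ y) ^ 2 * ((u x t + l) ^ α + (u y t + l) ^ α) * η t * K x y t)
          + (2 * Λ * S1 + 2 * Λ / l * S2) *
              (∫ t in Ioo a b, ∫ x in ball x₀ r, (u x t + l) ^ α * ψ x ^ 2 * η t)
          + 1 / (1 - α) *
              (∫ t in Ioo a b, ∫ x in ball x₀ r, (u x t + l) ^ α * ‖gradient ψ x‖ ^ 2 * η t)
          + 1 / α *
              (∫ t in Ioo a b, ∫ x in ball x₀ r, (u x t + l) ^ α * ψ x ^ 2 * |deriv η t|)) := by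
  have hK' := hK
  obtain ⟨hKm, hKs, hKb⟩ := hK'
  obtain ⟨hum, ⟨M, huM⟩, hus, hweak⟩ := hu
  obtain ⟨hα0, hα1⟩ := hα
  have hβ : 0 < 1 - α := by linarith
  have hrb : ball x₀ r ⊆ ball x₀ R := ball_subset_ball hrR.le
  have hv : ∀ x ∈ ball x₀ r, ∀ t ∈ Ioo a b, 0 < u x t + l := fun x hx t ht => by
    have := hupos x (hrb hx) t ht; linarith
  have hva : ∀ x ∈ ball x₀ r, ∀ t ∈ Ioo a b, 0 ≤ (u x t + l) ^ α := fun x hx t ht =>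
    (Real.rpow_pos_of_pos (hv x hx t ht) _).le
  have hvC : ∀ x ∈ ball x₀ r, ∀ t ∈ Ioo a b, (u x t + l) ^ α ≤ (M + l) ^ α := fun x hx t ht =>
    Real.rpow_le_rpow (hv x hx t ht).le
      (by have := (abs_le.1 (huM x t (hsubt ht))).2; linarith) hα0.le
  have hvm : Measurable fun p : E N × ℝ => (u p.1 p.2 + l) ^ α := by fun_prop
  have hψm : Measurable ψ := hψs.continuous.measurable
  have hηm : Measurable η := hηs.continuous.measurable
  have hη'c : Continuous (deriv η) := hηs.continuous_deriv (by simp)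
  have hη'm : Measurable (deriv η) := hη'c.measurable
  have hgψc : Continuous (gradient ψ) :=
    (LinearIsometryEquiv.continuous _).comp (hψs.continuous_fderiv (by simp))
  have hgψm : Measurable (gradient ψ) := hgψc.measurable
  obtain ⟨Cη, hCη⟩ : ∃ C, ∀ t ∈ Ioo a b, η t ≤ C := by
    obtain ⟨C, hC⟩ := (isCompact_Icc (a := a) (b := b)).exists_bound_of_continuousOn
      hηs.continuous.continuousOn
    exact ⟨C, fun t ht => (le_abs_self _).trans (hC t (Ioo_subset_Icc_self ht))⟩
  obtain ⟨Cd, hCd⟩ : ∃ C, ∀ t ∈ Ioo a b, |deriv η t| ≤ C := by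
    obtain ⟨C, hC⟩ := (isCompact_Icc (a := a) (b := b)).exists_bound_of_continuousOn
      hη'c.continuousOn
    exact ⟨C, fun t ht => (hC t (Ioo_subset_Icc_self ht))⟩
  obtain ⟨Cg, hCg⟩ : ∃ C, ∀ t ∈ Ioo a b, g t ≤ C := by
    obtain ⟨C, hC⟩ := (isCompact_Icc (a := a) (b := b)).exists_bound_of_continuousOn
      hgc.continuousOn
    exact ⟨C, fun t ht => (le_abs_self _).trans (hC t (Ioo_subset_Icc_self ht))⟩
  obtain ⟨Cψ, hCψ⟩ := hψs.continuous.bounded_above_of_compact_support hψc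
  have hψ2 : ∀ x, ψ x ^ 2 ≤ Cψ ^ 2 := fun x => by
    rw [← sq_abs]; exact pow_le_pow_left₀ (abs_nonneg _) (hCψ x) 2
  have hfc : HasCompactSupport (fderiv ℝ ψ) := hψc.fderiv (𝕜 := ℝ)
  obtain ⟨Cf, hCf⟩ := (hψs.continuous_fderiv (by simp)).bounded_above_of_compact_support hfc
  have hCgr : ∀ x, ‖gradient ψ x‖ ^ 2 ≤ Cf ^ 2 := fun x => by
    have : ‖gradient ψ x‖ = ‖fderiv ℝ ψ x‖ := LinearIsometryEquiv.norm_map _ _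
    rw [this]; exact pow_le_pow_left₀ (norm_nonneg _) (hCf x) 2
  have hL : ∀ x y, |ψ x - ψ y| ≤ Cf * ‖x - y‖ := fun x y => by
    have := Convex.norm_image_sub_le_of_norm_fderiv_le (𝕜 := ℝ) (f := ψ) (C := Cf) (s := univ)
      (fun x _ => (hψs.differentiable (by simp)) x) (fun x _ => hCf x) convex_univ
      (mem_univ y) (mem_univ x)
    exact this
  obtain ⟨hJi, hJ0⟩ := J_int N hN hs hΛ K hK x₀ hr hsubt ψ hψm hL (fun x t => (u x t + l) ^ α)
    hvm hva hvC η hηm hη0 hCη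
  obtain ⟨hIi, hI0, hIx⟩ := slice_int N x₀ (r := r) (a := a) (b := b)
    (C := (M + l) ^ α * Cψ ^ 2 * Cη) (fun x t => (u x t + l) ^ α * ψ x ^ 2 * η t)
    (by fun_prop) (fun x hx t ht => by have := hva x hx t ht; have := hη0 t; positivity)
    (fun x hx t ht => by
      have h1 := hva x hx t ht; have h2 := hη0 t; have h3 := hvC x hx t ht; have h4 := hCη t ht
      have h5 := hψ2 x; have h6 := h1.trans h3
      gcongr)
  obtain ⟨hGi, hG0, hGx⟩ := slice_int N x₀ (r := r) (a := a) (b := b)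
    (C := (M + l) ^ α * Cf ^ 2 * Cη) (fun x t => (u x t + l) ^ α * ‖gradient ψ x‖ ^ 2 * η t)
    (by fun_prop) (fun x hx t ht => by have := hva x hx t ht; have := hη0 t; positivity)
    (fun x hx t ht => by
      have h1 := hva x hx t ht; have h2 := hη0 t; have h3 := hvC x hx t ht; have h4 := hCη t ht
      have h5 := hCgr x; have h6 := h1.trans h3
      gcongr)
  obtain ⟨hDi, hD0, hDx⟩ := slice_int N x₀ (r := r) (a := a) (b := b)
    (C := (M + l) ^ α * Cψ ^ 2 * Cd) (fun x t => (u x t + l) ^ α * ψ x ^ 2 * |deriv η t|)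
    (by fun_prop) (fun x hx t ht => by have := hva x hx t ht; positivity)
    (fun x hx t ht => by
      have h1 := hva x hx t ht; have h3 := hvC x hx t ht; have h4 := hCd t ht
      have h5 := hψ2 x; have h6 := h1.trans h3
      gcongr)
  obtain ⟨hAi, hA0, hAx⟩ := slice_int N x₀ (r := r) (a := a) (b := b)
    (C := (M + l) ^ α * Cψ ^ 2 * Cg) (fun x t => (u x t + l) ^ α * ψ x ^ 2 * g t)
    (by fun_prop) (fun x hx t ht => by have := hva x hx t ht; have := hg0 t; positivity)
    (fun x hx t ht => by
      have h1 := hva x hx t ht; have h2 := hg0 t; have h3 := hvC x hx t ht; have h4 := hCg t ht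
      have h5 := hψ2 x; have h6 := h1.trans h3
      gcongr)
  refine ⟨setIntegral_nonneg measurableSet_Ioo hJ0, setIntegral_nonneg measurableSet_Ioo hI0,
    setIntegral_nonneg measurableSet_Ioo hG0, ?_⟩
  obtain ⟨hφs, hφc, hφsupp, hφ0⟩ := test_fun N (α := α) hΩo u hus x₀ hsubx hsubt hupos hrR hl ψ hψs
    hψc hψsupp θ hθs hθc hθsupp hθ0
  have hW := hweak (fun x t => (u x t + l) ^ (α - 1) * ψ x ^ 2 * θ t) hφs hφc hφsupp hφ0
  obtain ⟨hQ, hTT⟩ := time_term N hΩo u hum huM hus x₀ hsubx hsubt hupos hrR hl hα0 ψ hψs hψc hψsupp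
    θ hθs hθc hθsupp hθ0
  have hθz : ∀ t, t ∉ Ioo a b → θ t = 0 := fun t ht =>
    image_eq_zero_of_notMem_tsupport fun h => ht (hθsupp h)
  rw [hTT] at hW
  -- gradient term
  have hB : (∫ t in Ioo 0 T, ∫ x in Ω, ⟪gradient (fun y => u y t) x,
      gradient (fun y => (u y t + l) ^ (α - 1) * ψ y ^ 2 * θ t) x⟫) ≤
      2 * (1 / (1 - α) * ∫ t in Ioo a b, ∫ x in ball x₀ r,
        (u x t + l) ^ α * ‖gradient ψ x‖ ^ 2 * η t) := by
    rw [setIntegral_eq_of_subset_of_forall_sdiff_eq_zero measurableSet_Ioo hsubt]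
    · rw [← integral_const_mul, ← integral_const_mul]
      refine integral_le_trick ?_ ?_ ((hGi.const_mul _).const_mul _)
      · filter_upwards [ae_restrict_mem measurableSet_Ioo] with t ht
        rw [← integral_const_mul, ← integral_const_mul]
        have e : ∫ x in ball x₀ r, 2 * (1 / (1 - α) * ((u x t + l) ^ α * ‖gradient ψ x‖ ^ 2 * η t)) =
            ∫ x in Ω, (ball x₀ r).indicator
              (fun x => 2 * (1 / (1 - α) * ((u x t + l) ^ α * ‖gradient ψ x‖ ^ 2 * η t))) x := by
          rw [setIntegral_indicator measurableSet_ball, inter_eq_right.2 (hrb.trans hsubx)]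
        rw [e]
        refine integral_le_trick (Filter.Eventually.of_forall fun x => ?_)
          (Filter.Eventually.of_forall fun x => ?_) ?_
        · exact grad_est N hΩo u hus x₀ hsubx hsubt hupos hrR hl hα1 ψ hψs hψsupp ht (hθ0 t)
            (hθη t) x
        · apply indicator_nonneg
          intro x hx
          have h1 := hva x hx t ht; have h2 := hη0 t
          positivity
        · exact (IntegrableOn.integrable_indicator (((hGx t ht).const_mul _).const_mul _)
            measurableSet_ball).integrableOn
      · filter_upwards [ae_restrict_mem measurableSet_Ioo] with t ht
        have := hG0 t ht
        simp only [Pi.zero_apply]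
        positivity
    · intro t ht
      have : θ t = 0 := hθz t ht.2
      simp [this, gradient]
  -- nonlocal term
  have hC : (∫ t in Ioo 0 T, ∫ x : E N, ∫ y : E N, (u x t - u y t) *
      ((u x t + l) ^ (α - 1) * ψ x ^ 2 * θ t - (u y t + l) ^ (α - 1) * ψ y ^ 2 * θ t) * K x y t) ≤
      2 * (1 / (1 - α) * (∫ t in Ioo a b, ∫ x in ball x₀ r, ∫ y in ball x₀ r,
              (ψ x - ψ y) ^ 2 * ((u x t + l) ^ α + (u y t + l) ^ α) * η t * K x y t)
          + (2 * Λ * S1 + 2 * Λ / l * S2) *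
              (∫ t in Ioo a b, ∫ x in ball x₀ r, (u x t + l) ^ α * ψ x ^ 2 * η t)) := by
    rw [setIntegral_eq_of_subset_of_forall_sdiff_eq_zero measurableSet_Ioo hsubt]
    · rw [← integral_const_mul, ← integral_const_mul, ← integral_add (hJi.const_mul _)
        (hIi.const_mul _), ← integral_const_mul]
      refine integral_le_trick ?_ ?_ (((hJi.const_mul _).add (hIi.const_mul _)).const_mul _)
      · filter_upwards [ae_restrict_mem measurableSet_Ioo, hS2] with t ht hS2t
        exact nonlocal_est N hN hs hΛ (fun x y => K x y t)
          (hKm.comp (measurable_fst.prodMk (measurable_snd.prodMk measurable_const)))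
          (fun x y => hKs x y t)
          (fun x y hxy => ⟨le_trans (by positivity) (hKb x y hxy t (hsubt ht)).1,
            (hKb x y hxy t (hsubt ht)).2⟩) x₀ hr hrR hl ⟨hα0, hα1⟩ (fun x => u x t)
          (hum.comp (measurable_id.prodMk measurable_const)) (fun x => huM x t (hsubt ht))
          (fun x hx => hupos x hx t ht) ψ hψm hL hψ2 hψsupp
          (fun x hx => image_eq_zero_of_notMem_tsupport hx) hδ hSδ (hθ0 t) (hθη t)
          (fun x => (u x t + l) ^ (α - 1) * ψ x ^ 2 * θ t) (fun x => rfl) hS1 hS2t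
      · filter_upwards [ae_restrict_mem measurableSet_Ioo] with t ht
        have h1 := hJ0 t ht
        have h2 := hI0 t ht
        simp only [Pi.zero_apply]
        positivity
    · intro t ht
      have : θ t = 0 := hθz t ht.2
      simp [this]
  -- time term
  have hA : (∫ t in Ioo a b, (∫ x in ball x₀ r, (u x t + l) ^ α * ψ x ^ 2) * g t) -
      2 * (∫ t in Ioo a b, ∫ x in ball x₀ r, (u x t + l) ^ α * ψ x ^ 2 * |deriv η t|) ≤
      ∫ t in Ioo a b, ∫ x in ball x₀ r, (u x t + l) ^ α * ψ x ^ 2 * deriv θ t := by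
    simp only [← integral_mul_const]
    rw [← integral_const_mul, ← integral_sub hAi (hDi.const_mul _)]
    unfold IntegrableOn at hQ
    rw [← Measure.prod_restrict] at hQ
    refine setIntegral_mono_on (hAi.sub (hDi.const_mul _)) hQ.integral_prod_left measurableSet_Ioo ?_
    intro t ht
    have p0 : IntegrableOn (fun x => (u x t + l) ^ α * ψ x ^ 2) (ball x₀ r) := by
      refine IntegrableOn.of_bound (C := (M + l) ^ α * Cψ ^ 2) measure_ball_lt_top ?_ ?_
      · have : Measurable fun x => u x t := hum.comp (measurable_id.prodMk measurable_const)
        exact Measurable.aestronglyMeasurable (by fun_prop)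
      · filter_upwards [ae_restrict_mem measurableSet_ball] with x hx
        have h1 := hva x hx t ht; have h3 := hvC x hx t ht
        have h5 := hψ2 x; have h6 := h1.trans h3
        rw [Real.norm_of_nonneg (by positivity)]
        gcongr
    have q0 : 0 ≤ ∫ x in ball x₀ r, (u x t + l) ^ α * ψ x ^ 2 :=
      setIntegral_nonneg measurableSet_ball fun x hx => by
        have h1 := hva x hx t ht
        positivity
    simp only [integral_mul_const]
    nlinarith [hθ' t]
  have hA2 : 1 / α * ((∫ t in Ioo a b, (∫ x in ball x₀ r, (u x t + l) ^ α * ψ x ^ 2) * g t) -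
      2 * (∫ t in Ioo a b, ∫ x in ball x₀ r, (u x t + l) ^ α * ψ x ^ 2 * |deriv η t|)) ≤ _ :=
    mul_le_mul_of_nonneg_left hA (by positivity)
  have hfin := hA2.trans (by linarith [hW, hB, hC] : _ ≤ 2 * (1 / (1 - α) *
            (∫ t in Ioo a b, ∫ x in ball x₀ r, ∫ y in ball x₀ r,
              (ψ x - ψ y) ^ 2 * ((u x t + l) ^ α + (u y t + l) ^ α) * η t * K x y t)
          + (2 * Λ * S1 + 2 * Λ / l * S2) *
              (∫ t in Ioo a b, ∫ x in ball x₀ r, (u x t + l) ^ α * ψ x ^ 2 * η t)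
          + 1 / (1 - α) *
              (∫ t in Ioo a b, ∫ x in ball x₀ r, (u x t + l) ^ α * ‖gradient ψ x‖ ^ 2 * η t)))
  generalize (∫ t in Ioo a b, ∫ x in ball x₀ r, (u x t + l) ^ α * ψ x ^ 2 * |deriv η t|) = D at *
  generalize (∫ t in Ioo a b, (∫ x in ball x₀ r, (u x t + l) ^ α * ψ x ^ 2) * g t) = A at *
  have h9 := mul_le_mul_of_nonneg_left hfin hα0.le
  have e9 : α * (1 / α * (A - 2 * D)) = A - 2 * D := by field_simp
  have e10 : ∀ X : ℝ, 2 * α * (X + 1 / α * D) = α * (2 * X) + 2 * D := by intro X; field_simp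
  rw [e9] at h9
  rw [e10]
  linarith

lemma cont_I (N : ℕ) {T a b R r l α M : ℝ} {Ω : Set (E N)} (hΩo : IsOpen Ω) (u : E N → ℝ → ℝ)
    (hum : Measurable (fun p : E N × ℝ => u p.1 p.2))
    (huM : ∀ x t, t ∈ Ioo 0 T → |u x t| ≤ M)
    (hus : ContDiffOn ℝ (⊤ : ℕ∞) (fun p : E N × ℝ => u p.1 p.2) (Ω ×ˢ Ioo 0 T)) (x₀ : E N)
    (hsubx : ball x₀ R ⊆ Ω) (hsubt : Ioo a b ⊆ Ioo 0 T)
    (hupos : ∀ x ∈ ball x₀ R, ∀ t ∈ Ioo a b, 0 ≤ u x t) (hrR : r < R) (hl : 0 < l)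
    (hα : 0 < α)
    (ψ : E N → ℝ) (hψs : ContDiff ℝ (⊤ : ℕ∞) ψ) (hψc : HasCompactSupport ψ)
    {t₁ : ℝ} (ht₁ : t₁ ∈ Ioo a b) :
    ContinuousAt (fun t => ∫ x in ball x₀ r, (u x t + l) ^ α * ψ x ^ 2) t₁ := by
  have hrb : ball x₀ r ⊆ ball x₀ R := ball_subset_ball hrR.le
  obtain ⟨Cψ, hCψ⟩ := hψs.continuous.bounded_above_of_compact_support hψc
  have hψm : Measurable ψ := hψs.continuous.measurable
  have hψ2 : ∀ x, ψ x ^ 2 ≤ Cψ ^ 2 := fun x => by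
    rw [← sq_abs]; exact pow_le_pow_left₀ (abs_nonneg _) (hCψ x) 2
  refine continuousAt_of_dominated (bound := fun _ => (M + l) ^ α * Cψ ^ 2) ?_ ?_ ?_ ?_
  · refine Filter.Eventually.of_forall fun t => ?_
    have : Measurable fun x => u x t := hum.comp (measurable_id.prodMk measurable_const)
    exact Measurable.aestronglyMeasurable (by fun_prop)
  · filter_upwards [isOpen_Ioo.mem_nhds ht₁] with t ht
    filter_upwards [ae_restrict_mem measurableSet_ball] with x hx
    have h0 := hupos x (hrb hx) t ht
    have h2 := (abs_le.1 (huM x t (hsubt ht))).2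
    have h1 : 0 ≤ (u x t + l) ^ α := by positivity
    have h3 : (u x t + l) ^ α ≤ (M + l) ^ α :=
      Real.rpow_le_rpow (by positivity) (by linarith) hα.le
    have h5 := hψ2 x
    have h6 := h1.trans h3
    rw [Real.norm_of_nonneg (by positivity)]
    gcongr
  · exact integrableOn_const (measure_ball_lt_top.ne)
  · filter_upwards [ae_restrict_mem measurableSet_ball] with x hx
    have h0 := hupos x (hrb hx) t₁ ht₁
    have hmem : ((x, t₁) : E N × ℝ) ∈ Ω ×ˢ Ioo 0 T := mk_mem_prod (hsubx (hrb hx)) (hsubt ht₁)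
    have hu0 : ContDiffAt ℝ (⊤ : ℕ∞) (fun p : E N × ℝ => u p.1 p.2) (x, t₁) :=
      hus.contDiffAt ((hΩo.prod isOpen_Ioo).mem_nhds hmem)
    have hu : ContinuousAt (fun p : E N × ℝ => u p.1 p.2) (x, t₁) := hu0.continuousAt
    have hu1 : ContinuousAt (fun t => u x t) t₁ :=
      ContinuousAt.comp (f := fun t : ℝ => ((x, t) : E N × ℝ)) (x := t₁) hu (by fun_prop)
    exact ((hu1.add continuousAt_const).rpow_const (Or.inr hα.le)).mul continuousAt_const

theorem stmt_11 (N : ℕ) (hN : 2 ≤ N) (s Λ T : ℝ) (hs : s ∈ Set.Ioo (0 : ℝ) 1)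
    (hΛ : 1 ≤ Λ) (hT : 0 < T)
    (Ω : Set (E N)) (hΩo : IsOpen Ω) (hΩb : Bornology.IsBounded Ω)
    (K : E N → E N → ℝ → ℝ) (hK : KernelOK N s Λ T K)
    (u : E N → ℝ → ℝ) (hu : IsWeakSupersolution N T K Ω u)
    (x₀ : E N) (R r τ τ₁ τ₂ l α : ℝ)
    (hτ : 0 < τ) (hτ₁₂ : τ₁ < τ₂)
    (hsubx : Metric.ball x₀ R ⊆ Ω) (hsubt : Set.Ioo τ₁ (τ₂ + τ) ⊆ Set.Ioo 0 T)
    (hupos : ∀ x ∈ Metric.ball x₀ R, ∀ t ∈ Set.Ioo τ₁ (τ₂ + τ), 0 ≤ u x t)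
    (hr : 0 < r) (hr1 : r ≤ 1) (hrR : r < R) (hl : 0 < l) (hα : α ∈ Set.Ioo (0 : ℝ) 1)
    (ψ : E N → ℝ) (hψs : ContDiff ℝ (⊤ : ℕ∞) ψ) (hψc : HasCompactSupport ψ)
    (hψsupp : tsupport ψ ⊆ Metric.ball x₀ r) (hψ0 : ∀ x, 0 ≤ ψ x)
    (η : ℝ → ℝ) (hηs : ContDiff ℝ (⊤ : ℕ∞) η) (hη0 : ∀ t, 0 ≤ η t)
    (hη1 : ∀ t, τ₁ ≤ t → t ≤ τ₂ → η t = 1) (hη2 : ∀ t, τ₂ + τ ≤ t → η t = 0) :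
    essSup
        (fun t => ∫ x in Metric.ball x₀ r, (u x t + l) ^ α * ψ x ^ 2)
        (volume.restrict (Set.Ioo τ₁ τ₂)) ≤
      (2 * α) *
        ((4 * (1 - α) / α + 9 / (1 - α)) *
            (∫ t in Set.Ioo τ₁ (τ₂ + τ), ∫ x in Metric.ball x₀ r, ∫ y in Metric.ball x₀ r,
              (ψ x - ψ y) ^ 2 * ((u x t + l) ^ α + (u y t + l) ^ α) * η t * K x y t)
          + 2 * Λ *
              (⨆ x ∈ tsupport ψ,
                ∫ y in (Metric.ball x₀ r)ᶜ, ‖x - y‖ ^ (-((N : ℝ) + 2 * s))) *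
              (∫ t in Set.Ioo τ₁ (τ₂ + τ), ∫ x in Metric.ball x₀ r,
                (u x t + l) ^ α * ψ x ^ 2 * η t)
          + (2 * Λ / l) *
              essSup
                (fun t => ⨆ x ∈ tsupport ψ,
                  ∫ y in (Metric.ball x₀ R)ᶜ,
                    uminus N u y t * ‖x - y‖ ^ (-((N : ℝ) + 2 * s)))
                (volume.restrict (Set.Ioo τ₁ (τ₂ + τ))) *
              (∫ t in Set.Ioo τ₁ (τ₂ + τ), ∫ x in Metric.ball x₀ r,
                (u x t + l) ^ α * ψ x ^ 2 * η t)
          + (2 / (1 - α)) *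
              (∫ t in Set.Ioo τ₁ (τ₂ + τ), ∫ x in Metric.ball x₀ r,
                (u x t + l) ^ α * ‖gradient ψ x‖ ^ 2 * η t)
          + (1 / α) *
              (∫ t in Set.Ioo τ₁ (τ₂ + τ), ∫ x in Metric.ball x₀ r,
                (u x t + l) ^ α * ψ x ^ 2 * |deriv η t|)) := by
  have hu' := hu
  obtain ⟨hum, ⟨M, huM⟩, hus, hweak⟩ := hu'
  obtain ⟨hα0, hα1⟩ := hα
  have hβ : 0 < 1 - α := by linarith
  have hrb : ball x₀ r ⊆ ball x₀ R := ball_subset_ball hrR.le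
  have hab : τ₁ < τ₂ + τ := by linarith
  have hneab : (volume.restrict (Ioo τ₁ (τ₂ + τ))) ≠ 0 := by
    rw [Ne, Measure.restrict_eq_zero, Real.volume_Ioo, ENNReal.ofReal_eq_zero]; linarith
  obtain ⟨δ, hδ, hδs⟩ := hψc.isCompact.exists_thickening_subset_open isOpen_ball hψsupp
  have hSδ : ∀ x ∈ tsupport ψ, ∀ y ∈ (ball x₀ r)ᶜ, δ ≤ ‖x - y‖ := by
    intro x hx y hy
    by_contra h
    push Not at h
    apply hy (hδs _)
    rw [mem_thickening_iff]
    exact ⟨x, hx, by rwa [dist_comm, dist_eq_norm]⟩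
  set kf : ℝ := ∫ z : E N, (if δ ≤ ‖z‖ then ‖z‖ ^ (-((N : ℝ) + 2 * s)) else 0) with hkf
  have hkf0 : 0 ≤ kf := integral_nonneg fun z => by
    simp only [Pi.zero_apply]; split_ifs <;> positivity
  -- first supremum
  set S1 : ℝ := ⨆ x ∈ tsupport ψ, ∫ y in (ball x₀ r)ᶜ, ‖x - y‖ ^ (-((N : ℝ) + 2 * s)) with hS1d
  have gen : ∀ (f : E N → ℝ) (C : ℝ), 0 ≤ C → (∀ x, 0 ≤ f x) → (∀ x ∈ tsupport ψ, f x ≤ C) →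
      0 ≤ (⨆ x ∈ tsupport ψ, f x) ∧ (⨆ x ∈ tsupport ψ, f x) ≤ C ∧
      ∀ x ∈ tsupport ψ, f x ≤ ⨆ x ∈ tsupport ψ, f x := by
    intro f C hC hf0 hfC
    have hb : ∀ x, (⨆ _ : x ∈ tsupport ψ, f x) ≤ C := fun x => Real.iSup_le (fun h => hfC x h) hC
    refine ⟨Real.iSup_nonneg fun x => Real.iSup_nonneg fun _ => hf0 x, Real.iSup_le hb hC, ?_⟩
    intro x hx
    have h1 : (⨆ _ : x ∈ tsupport ψ, f x) = f x := ciSup_pos hx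
    rw [← h1]
    exact le_ciSup (f := fun x => ⨆ _ : x ∈ tsupport ψ, f x) ⟨C, by rintro _ ⟨x, rfl⟩; exact hb x⟩ x
  obtain ⟨hS10, -, hS1⟩ := gen (fun x => ∫ y in (ball x₀ r)ᶜ, ‖x - y‖ ^ (-((N : ℝ) + 2 * s)))
    (1 * kf) (by positivity) (fun x => integral_nonneg fun y => by simp only [Pi.zero_apply]; positivity)
    (fun x hx => by
      have := far_bound N hN hs.1 hδ measurableSet_ball.compl x (hSδ x hx) (w := fun _ => 1)
        measurable_const (M := 1) (by simp)
      simp only [one_mul] at this ⊢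
      exact this)
  -- second supremum
  set f2 : ℝ → ℝ := fun t => ⨆ x ∈ tsupport ψ, ∫ y in (ball x₀ R)ᶜ,
    uminus N u y t * ‖x - y‖ ^ (-((N : ℝ) + 2 * s)) with hf2
  set S2 : ℝ := essSup f2 (volume.restrict (Ioo τ₁ (τ₂ + τ))) with hS2d
  have hf2p : ∀ t ∈ Ioo τ₁ (τ₂ + τ), 0 ≤ f2 t ∧ f2 t ≤ |M| * kf ∧ ∀ x ∈ tsupport ψ,
      ∫ y in (ball x₀ R)ᶜ, uminus N u y t * ‖x - y‖ ^ (-((N : ℝ) + 2 * s)) ≤ f2 t := by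
    intro t ht
    have hut : Measurable fun x => u x t := hum.comp (measurable_id.prodMk measurable_const)
    refine gen (fun x => ∫ y in (ball x₀ R)ᶜ, uminus N u y t * ‖x - y‖ ^ (-((N : ℝ) + 2 * s)))
      (|M| * kf) (by positivity) (fun x => integral_nonneg fun y => ?_) (fun x hx => ?_)
    · have : 0 ≤ uminus N u y t := le_max_right _ _
      simp only [Pi.zero_apply]; positivity
    · refine far_bound N hN hs.1 hδ measurableSet_ball.compl x
        (fun y hy => hSδ x hx y (fun h => hy (hrb h))) (w := fun y => uminus N u y t) ?_ ?_
      · exact hut.neg.max measurable_const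
      · intro y
        have h1 := huM y t (hsubt ht)
        have h2 : |uminus N u y t| ≤ |u y t| := by
          unfold uminus
          rw [abs_of_nonneg (le_max_right _ _)]
          exact max_le (neg_le_abs _) (abs_nonneg _)
        exact h2.trans (h1.trans (le_abs_self _))
  have hf2b : Filter.IsBoundedUnder (· ≤ ·) (ae (volume.restrict (Ioo τ₁ (τ₂ + τ)))) f2 :=
    ⟨|M| * kf, by
      rw [Filter.eventually_map]
      filter_upwards [ae_restrict_mem measurableSet_Ioo] with t ht
      exact (hf2p t ht).2.1⟩
  have hae : ∀ᵐ t ∂(volume.restrict (Ioo τ₁ (τ₂ + τ))), f2 t ≤ S2 := ae_le_essSup hf2b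
  have hS2 : ∀ᵐ t ∂(volume.restrict (Ioo τ₁ (τ₂ + τ))), ∀ x ∈ tsupport ψ,
      ∫ y in (ball x₀ R)ᶜ, max (-(u y t)) 0 * ‖x - y‖ ^ (-((N : ℝ) + 2 * s)) ≤ S2 := by
    filter_upwards [hae, ae_restrict_mem measurableSet_Ioo] with t h1 ht x hx
    exact ((hf2p t ht).2.2 x hx).trans h1
  have hS20 : 0 ≤ S2 := by
    have : (ae (volume.restrict (Ioo τ₁ (τ₂ + τ)))).NeBot := ae_neBot.2 hneab
    obtain ⟨t, h1, ht⟩ := (hae.and (ae_restrict_mem measurableSet_Ioo)).exists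
    exact (hf2p t ht).1.trans h1
  set Cst : ℝ := (2 * α) * _ with hCst
  have main : ∀ t₁ ∈ Ioo τ₁ τ₂, ∫ x in ball x₀ r, (u x t₁ + l) ^ α * ψ x ^ 2 ≤ Cst := by
    intro t₁ ht₁
    by_contra hcon
    push Not at hcon
    set I : ℝ → ℝ := fun t => ∫ x in ball x₀ r, (u x t + l) ^ α * ψ x ^ 2 with hI
    have hcont : ContinuousAt I t₁ := cont_I N hΩo u hum huM hus x₀ hsubx hsubt hupos hrR hl hα0
      ψ hψs hψc ⟨ht₁.1, by linarith [ht₁.2]⟩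
    obtain ⟨C', hC1, hC2⟩ := exists_between hcon
    have hev : ∀ᶠ t in nhds t₁, C' < I t := hcont.eventually (lt_mem_nhds hC2)
    obtain ⟨ε, hε, hball⟩ := Metric.eventually_nhds_iff_ball.1 hev
    obtain ⟨ε', hε', hb1, hb2⟩ : ∃ ε', 0 < ε' ∧ ε' ≤ ε ∧ τ₁ < t₁ - ε' ∧ t₁ + ε' < τ₂ := by
      have h1 := ht₁.1
      have h2 := ht₁.2
      refine ⟨min ε (min ((t₁ - τ₁) / 2) ((τ₂ - t₁) / 2)), ?_, min_le_left _ _, ?_, ?_⟩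
      · refine lt_min hε (lt_min ?_ ?_) <;> linarith
      · have := (min_le_right ε (min ((t₁ - τ₁) / 2) ((τ₂ - t₁) / 2))).trans (min_le_left _ _)
        linarith
      · have := (min_le_right ε (min ((t₁ - τ₁) / 2) ((τ₂ - t₁) / 2))).trans (min_le_right _ _)
        linarith
    obtain ⟨hb2, hb3⟩ := hb2
    obtain ⟨θ, g, hθs, hθc, hθsupp, hθ0, hθη, hgc, hg0, hgz, hg1, hθ'⟩ :=
      exists_cutoff (τ := τ) hε' hb2 hb3 η hηs hη0 hη1 hη2
    obtain ⟨hJ0, hI0, hG0, hcore⟩ := core N hN hs hΛ Ω hΩo K hK u hu x₀ hsubx hsubt hupos hr hrR hl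
      ⟨hα0, hα1⟩ ψ hψs hψc hψsupp hδ hSδ η hηs hη0 hS10 hS20 hS1 hS2 θ g hθs hθc hθsupp hθ0 hθη hgc
      hg0 hθ'
    have hlow : C' ≤ ∫ t in Ioo τ₁ (τ₂ + τ), I t * g t := by
      have hsubb : ball t₁ ε' ⊆ Ioo τ₁ (τ₂ + τ) := by
        rw [Real.ball_eq_Ioo]
        intro t ht
        exact ⟨by linarith [ht.1], by linarith [ht.2]⟩
      have hgzi : ∀ t, t ∉ Ioo τ₁ (τ₂ + τ) → g t = 0 := fun t ht => hgz t fun h => ht (hsubb h)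
      have hgi : Integrable g := by
        by_contra h
        rw [integral_undef h] at hg1
        norm_num at hg1
      have e1 : ∫ t in Ioo τ₁ (τ₂ + τ), C' * g t = C' := by
        rw [integral_const_mul, setIntegral_eq_integral_of_forall_compl_eq_zero hgzi, hg1, mul_one]
      rw [← e1]
      have hψb : ∃ Cψ, ∀ x, ψ x ^ 2 ≤ Cψ := by
        obtain ⟨Cψ, hCψ⟩ := hψs.continuous.bounded_above_of_compact_support hψc
        exact ⟨Cψ ^ 2, fun x => by
          rw [← sq_abs]; exact pow_le_pow_left₀ (abs_nonneg _) (hCψ x) 2⟩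
      obtain ⟨Cψ, hCψ⟩ := hψb
      have hψm : Measurable ψ := hψs.continuous.measurable
      have hva : ∀ x ∈ ball x₀ r, ∀ t ∈ Ioo τ₁ (τ₂ + τ), 0 ≤ (u x t + l) ^ α := fun x hx t ht => by
        have := hupos x (hrb hx) t ht; positivity
      have hvC : ∀ x ∈ ball x₀ r, ∀ t ∈ Ioo τ₁ (τ₂ + τ), (u x t + l) ^ α ≤ (M + l) ^ α :=
        fun x hx t ht => Real.rpow_le_rpow (by have := hupos x (hrb hx) t ht; positivity)
          (by have := (abs_le.1 (huM x t (hsubt ht))).2; linarith) hα0.le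
      obtain ⟨Cg, hCg⟩ : ∃ C, ∀ t ∈ Ioo τ₁ (τ₂ + τ), g t ≤ C := by
        obtain ⟨C, hC⟩ := (isCompact_Icc (a := τ₁) (b := τ₂ + τ)).exists_bound_of_continuousOn
          hgc.continuousOn
        exact ⟨C, fun t ht => (le_abs_self _).trans (hC t (Ioo_subset_Icc_self ht))⟩
      obtain ⟨hAi, -, -⟩ := slice_int N x₀ (r := r) (a := τ₁) (b := τ₂ + τ)
        (C := (M + l) ^ α * Cψ * Cg) (fun x t => (u x t + l) ^ α * ψ x ^ 2 * g t)
        (by fun_prop) (fun x hx t ht => by have := hva x hx t ht; have := hg0 t; positivity)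
        (fun x hx t ht => by
          have h1 := hva x hx t ht; have h2 := hg0 t; have h3 := hvC x hx t ht; have h4 := hCg t ht
          have h5 := hCψ x; have h6 := h1.trans h3
          have h7 := (sq_nonneg (ψ x)).trans h5
          gcongr)
      simp only [integral_mul_const] at hAi
      refine integral_mono (hgi.integrableOn.const_mul _) hAi ?_
      intro t
      by_cases ht : t ∈ ball t₁ ε'
      · exact mul_le_mul_of_nonneg_right (hball t (ball_subset_ball hb1 ht)).le (hg0 t)
      · simp [hgz t ht]
    have hle : ∫ t in Ioo τ₁ (τ₂ + τ), I t * g t ≤ Cst := by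
      refine hcore.trans ?_
      rw [hCst]
      have c1 : 1 / (1 - α) ≤ 4 * (1 - α) / α + 9 / (1 - α) := by
        have : 0 ≤ 4 * (1 - α) / α := by positivity
        have : 1 / (1 - α) ≤ 9 / (1 - α) := by gcongr; norm_num
        linarith
      have c2 : 1 / (1 - α) ≤ 2 / (1 - α) := by gcongr; norm_num
      have d1 := mul_le_mul_of_nonneg_right c1 hJ0
      have d2 := mul_le_mul_of_nonneg_right c2 hG0
      refine mul_le_mul_of_nonneg_left ?_ (by positivity)
      rw [add_mul]
      linarith
    linarith
  have hne : (volume.restrict (Ioo τ₁ τ₂)) ≠ 0 := by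
    rw [Ne, Measure.restrict_eq_zero, Real.volume_Ioo, ENNReal.ofReal_eq_zero]; linarith
  have : (ae (volume.restrict (Ioo τ₁ τ₂))).NeBot := ae_neBot.2 hne
  refine Filter.limsup_le_of_le ?_ ?_
  · refine Filter.IsBoundedUnder.isCoboundedUnder_le ⟨0, ?_⟩
    rw [Filter.eventually_map]
    filter_upwards [ae_restrict_mem measurableSet_Ioo] with t ht
    refine setIntegral_nonneg measurableSet_ball fun x hx => ?_
    have := hupos x (hrb hx) t ⟨ht.1, by linarith [ht.2]⟩
    positivity
  · filter_upwards [ae_restrict_mem measurableSet_Ioo] with t ht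
    exact main t ht
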